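/- arXiv:0803.0722 — 2 statements merged into one kernel-verified Lean document; each statement's English description precedes it below -/
import Mathlib

section
/- The variety NT_n^0, the Zariski closure of the set of pairs (X,Y) of commuting strictly upper triangular n×n matrices with X and Y regular nilpotent in U_n (minimal polynomial of X of degree n-... i.e., X a regular element of U_n), is irreducible of dimension n(n+1)/2 - 1. -/
open Matrix Polynomial

/-- Points of the affine space `T_n × T_n` (resp. `U_n × U_n`), encoded as functions
from (index pairs for X) ⊕ (index pairs for Y) to the field. -/
abbrev Pt (n : ℕ) (K : Type*) := ((Fin n × Fin n) ⊕ (Fin n × Fin n)) → K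

/-- The Zariski topology on the affine space of pairs of matrices: generated by
complements of zero loci of polynomials. -/
noncomputable instance ptTop (n : ℕ) (K : Type*) [CommRing K] : TopologicalSpace (Pt n K) :=
  TopologicalSpace.generateFrom
    { U | ∃ p : MvPolynomial ((Fin n × Fin n) ⊕ (Fin n × Fin n)) K,
        U = {x | MvPolynomial.eval x p ≠ 0} }

/-- The first matrix of the pair encoded by a point. -/
def Xof {n : ℕ} {K : Type*} (x : Pt n K) : Matrix (Fin n) (Fin n) K :=
  Matrix.of fun i j => x (Sum.inl (i, j))

/-- The second matrix of the pair encoded by a point. -/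
def Yof {n : ℕ} {K : Type*} (x : Pt n K) : Matrix (Fin n) (Fin n) K :=
  Matrix.of fun i j => x (Sum.inr (i, j))

/-- `CT_n`: pairs of commuting upper triangular matrices. -/
def CTset (n : ℕ) (K : Type*) [CommRing K] : Set (Pt n K) :=
  {x | (∀ i j, j < i → Xof x i j = 0) ∧ (∀ i j, j < i → Yof x i j = 0) ∧
    Xof x * Yof x = Yof x * Xof x}

/-- `NT_n`: pairs of commuting strictly upper triangular matrices. -/
def NTset (n : ℕ) (K : Type*) [CommRing K] : Set (Pt n K) :=
  {x | (∀ i j, j ≤ i → Xof x i j = 0) ∧ (∀ i j, j ≤ i → Yof x i j = 0) ∧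
    Xof x * Yof x = Yof x * Xof x}

/-- `CT_n^0`: the Zariski closure of the set of commuting pairs of regular
(minimal polynomial of degree `n`) upper triangular matrices. -/
def CT0 (n : ℕ) (K : Type*) [Field K] : Set (Pt n K) :=
  closure {x | x ∈ CTset n K ∧ (minpoly K (Xof x)).natDegree = n ∧
    (minpoly K (Yof x)).natDegree = n}

/-- The subspace of strictly upper triangular matrices. -/
def sutSub (n : ℕ) (K : Type*) [Field K] : Submodule K (Matrix (Fin n) (Fin n) K) where
  carrier := {M | ∀ i j, j ≤ i → M i j = 0}
  add_mem' := by
    intro a b ha hb i j hij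
    simp [Matrix.add_apply, ha i j hij, hb i j hij]
  zero_mem' := by intro i j hij; simp
  smul_mem' := by
    intro c M hM i j hij
    simp [Matrix.smul_apply, hM i j hij]

/-- `X` is a regular element of `U_n`: it is strictly upper triangular and its
centralizer in `U_n` has the minimal dimension `n - 1`. -/
def regU {n : ℕ} {K : Type*} [Field K] (X : Matrix (Fin n) (Fin n) K) : Prop :=
  (∀ i j, j ≤ i → X i j = 0) ∧
  Module.finrank K
    ↥(sutSub n K ⊓ LinearMap.ker (LinearMap.mulLeft K X - LinearMap.mulRight K X)) = n - 1

/-- `NT_n^0`: the Zariski closure of the set of commuting pairs of regular strictly upper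
triangular matrices. -/
def NT0 (n : ℕ) (K : Type*) [Field K] : Set (Pt n K) :=
  closure {x | x ∈ NTset n K ∧ regU (Xof x) ∧ regU (Yof x)}

section StrictlyUpperTriangular

variable {n m : ℕ} {R K : Type*} [CommRing R] [Field K]

/-- A square matrix is strictly upper triangular. -/
def IsSUT (X : Matrix (Fin n) (Fin n) R) : Prop := ∀ i j, j ≤ i → X i j = 0

theorem IsSUT.mul {X Y : Matrix (Fin n) (Fin n) R} (hX : IsSUT X) (hY : IsSUT Y) :
    IsSUT (X * Y) := fun i j hij => by
  rw [Matrix.mul_apply]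
  refine Finset.sum_eq_zero fun l _ => ?_
  rcases le_total l i with h | h
  · rw [hX i l h, zero_mul]
  · rw [hY l j (hij.trans h), mul_zero]

theorem IsSUT.pow_succ {X : Matrix (Fin n) (Fin n) R} (hX : IsSUT X) (k : ℕ) :
    IsSUT (X ^ (k + 1)) := by
  induction k with
  | zero => simpa using hX
  | succ k ih => rw [_root_.pow_succ]; exact ih.mul hX

/-- The matrix whose `k`-th row is the first row of `X ^ (k + 1)`, without its first entry. -/
def firstRows (X : Matrix (Fin (m + 1)) (Fin (m + 1)) R) : Matrix (Fin m) (Fin m) R :=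
  Matrix.of fun k j => (X ^ (k.val + 1)) 0 j.succ

/-- The polynomial in `X` without constant term whose coefficients are `c`. -/
def polyOf (c : Fin m → R) (X : Matrix (Fin n) (Fin n) R) : Matrix (Fin n) (Fin n) R :=
  ∑ k, c k • X ^ (k.val + 1)

theorem polyOf_zero_succ (c : Fin m → R) (X : Matrix (Fin (m + 1)) (Fin (m + 1)) R) (j : Fin m) :
    polyOf c X 0 j.succ = (c ᵥ* firstRows X) j := by
  simp [polyOf, firstRows, Matrix.sum_apply, Matrix.vecMul, dotProduct]

theorem isSUT_polyOf (c : Fin m → R) {X : Matrix (Fin n) (Fin n) R} (hX : IsSUT X) :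
    IsSUT (polyOf c X) := fun i j hij => by
  rw [polyOf, Matrix.sum_apply]
  exact Finset.sum_eq_zero fun k _ => by simp [hX.pow_succ k i j hij]

theorem mul_polyOf (c : Fin m → R) (X : Matrix (Fin n) (Fin n) R) :
    X * polyOf c X = polyOf c X * X := by
  simp only [polyOf, Finset.mul_sum, Finset.sum_mul, Matrix.mul_smul, Matrix.smul_mul,
    ← _root_.pow_succ, ← _root_.pow_succ']

theorem eq_zero_of_firstRow_eq_zero {X Y : Matrix (Fin (m + 1)) (Fin (m + 1)) K} (hX : IsSUT X)
    (hdet : (firstRows X).det ≠ 0) (hXY : X * Y = Y * X) (hY : ∀ j, Y 0 j = 0) : Y = 0 := by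
  have hpow (k : ℕ) (j) : (X ^ k * Y) 0 j = 0 := by
    rw [((show Commute X Y from hXY).pow_left k).eq, Matrix.mul_apply]
    exact Finset.sum_eq_zero fun l _ => by rw [hY, zero_mul]
  have hmul : firstRows X * Matrix.of (fun i j => Y (Fin.succ i) j) = 0 := by
    ext k j
    have := hpow (k.val + 1) j
    rw [Matrix.mul_apply, Fin.sum_univ_succ, hX.pow_succ k 0 0 le_rfl, zero_mul, zero_add] at this
    simpa [Matrix.mul_apply, firstRows] using this
  have hinv : IsUnit (firstRows X).det := hdet.isUnit
  have hzero : Matrix.of (fun i j => Y (Fin.succ i) j) = 0 := by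
    rw [← Matrix.one_mul (Matrix.of _), ← Matrix.nonsing_inv_mul _ hinv, Matrix.mul_assoc, hmul,
      Matrix.mul_zero]
  ext i j
  refine Fin.cases (hY j) (fun i => ?_) i
  exact congrFun (congrFun hzero i) j

theorem exists_eq_polyOf {X Y : Matrix (Fin (m + 1)) (Fin (m + 1)) K} (hX : IsSUT X)
    (hY : IsSUT Y) (hdet : (firstRows X).det ≠ 0) (hXY : X * Y = Y * X) :
    ∃ c : Fin m → K, Y = polyOf c X := by
  refine ⟨(fun j => Y 0 j.succ) ᵥ* (firstRows X)⁻¹, sub_eq_zero.1 ?_⟩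
  refine eq_zero_of_firstRow_eq_zero hX hdet ?_ fun j => ?_
  · rw [mul_sub, sub_mul, hXY, mul_polyOf]
  · rw [Matrix.sub_apply]
    refine Fin.cases ?_ (fun j => ?_) j
    · rw [hY 0 0 le_rfl, isSUT_polyOf _ hX 0 0 le_rfl, sub_zero]
    · rw [polyOf_zero_succ, Matrix.vecMul_vecMul, Matrix.nonsing_inv_mul _ hdet.isUnit,
        Matrix.vecMul_one, sub_self]

theorem mem_sutSub_inf_ker_iff {X Y : Matrix (Fin n) (Fin n) K} :
    Y ∈ sutSub n K ⊓ LinearMap.ker (LinearMap.mulLeft K X - LinearMap.mulRight K X) ↔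
      IsSUT Y ∧ X * Y = Y * X := by
  simp only [Submodule.mem_inf, LinearMap.mem_ker, LinearMap.sub_apply, LinearMap.mulLeft_apply,
    LinearMap.mulRight_apply, sub_eq_zero]
  rfl

theorem regU_of_det_firstRows_ne_zero {X : Matrix (Fin (m + 1)) (Fin (m + 1)) K} (hX : IsSUT X)
    (hdet : (firstRows X).det ≠ 0) : regU X := by
  refine ⟨hX, ?_⟩
  let T : ↥(sutSub (m + 1) K ⊓
      LinearMap.ker (LinearMap.mulLeft K X - LinearMap.mulRight K X)) →ₗ[K] (Fin m → K) :=
    { toFun := fun Y j => Y.1 0 j.succ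
      map_add' := fun _ _ => rfl
      map_smul' := fun _ _ => rfl }
  have hT : Function.Bijective T := by
    constructor
    · rw [← LinearMap.ker_eq_bot, LinearMap.ker_eq_bot']
      rintro ⟨Y, hY⟩ h
      obtain ⟨hY, hXY⟩ := mem_sutSub_inf_ker_iff.1 hY
      refine Subtype.ext (eq_zero_of_firstRow_eq_zero hX hdet hXY fun j => ?_)
      exact Fin.cases (hY 0 0 le_rfl) (fun j => congrFun h j) j
    · intro v
      refine ⟨⟨polyOf (v ᵥ* (firstRows X)⁻¹) X,
        mem_sutSub_inf_ker_iff.2 ⟨isSUT_polyOf _ hX, mul_polyOf _ X⟩⟩, funext fun j => ?_⟩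
      change polyOf _ X 0 j.succ = v j
      rw [polyOf_zero_succ, Matrix.vecMul_vecMul, Matrix.nonsing_inv_mul _ hdet.isUnit,
        Matrix.vecMul_one]
  rw [(LinearEquiv.ofBijective T hT).finrank_eq, Module.finrank_fin_fun, Nat.add_sub_cancel]

/-- The nilpotent Jordan block. -/
def shiftMatrix (n : ℕ) (R : Type*) [CommRing R] : Matrix (Fin n) (Fin n) R :=
  Matrix.of fun i j => if i.val + 1 = j.val then 1 else 0

theorem shiftMatrix_apply (i j : Fin n) :
    shiftMatrix n R i j = if i.val + 1 = j.val then 1 else 0 := rfl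

theorem isSUT_shiftMatrix : IsSUT (shiftMatrix n R) := fun i j hij => by
  have : ¬ i.val + 1 = j.val := by have := Fin.le_def.1 hij; omega
  simp [shiftMatrix, this]

theorem firstRows_shiftMatrix : firstRows (shiftMatrix (m + 1) R) = 1 := by
  have key (k : ℕ) (j : Fin (m + 1)) :
      (shiftMatrix (m + 1) R ^ k) 0 j = if k = j.val then 1 else 0 := by
    induction k generalizing j with
    | zero => simp [Matrix.one_apply, Fin.ext_iff]
    | succ k ih =>
      rw [_root_.pow_succ, Matrix.mul_apply]
      simp only [ih, shiftMatrix_apply, mul_ite, mul_one, mul_zero, ← ite_and]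
      by_cases h : k + 1 = j.val
      · rw [if_pos h, Finset.sum_eq_single ⟨k, by omega⟩]
        · simp [h]
        · intro b _ hb
          have : ¬ k = b.val := fun hk => hb (Fin.ext hk.symm)
          simp [this]
        · simp
      · rw [if_neg h]
        refine Finset.sum_eq_zero fun l _ => ?_
        have : ¬ (l.val + 1 = j.val ∧ k = l.val) := by omega
        rw [if_neg this]
  ext k j
  simp [firstRows, key, Matrix.one_apply, Fin.ext_iff]

theorem exists_polyOf_shiftMatrix_eq :
    ∃ c : Fin m → R, polyOf c (shiftMatrix (m + 1) R) = shiftMatrix (m + 1) R := by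
  cases m with
  | zero => exact ⟨0, by ext i j; fin_cases i; fin_cases j; simp [polyOf, shiftMatrix]⟩
  | succ m =>
    refine ⟨Pi.single 0 1, ?_⟩
    rw [polyOf, Finset.sum_eq_single 0]
    · simp
    · intro k _ hk
      simp [hk]
    · simp

variable {S : Type*} [CommRing S]

theorem firstRows_map (f : R →+* S) (X : Matrix (Fin (m + 1)) (Fin (m + 1)) R) :
    firstRows (f.mapMatrix X) = f.mapMatrix (firstRows X) := by
  ext k j
  simp only [firstRows, ← map_pow]
  rfl

theorem polyOf_map (f : R →+* S) (c : Fin m → R) (X : Matrix (Fin n) (Fin n) R) :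
    polyOf (f ∘ c) (f.mapMatrix X) = f.mapMatrix (polyOf c X) := by
  simp only [polyOf, map_sum, ← map_pow]
  refine Finset.sum_congr rfl fun k _ => ?_
  ext i j
  simp

end StrictlyUpperTriangular
section KernelPencil

variable {K ι W : Type*} [Field K] [Fintype ι] [DecidableEq ι] [AddCommGroup W] [Module K W]

theorem exists_leftInverse_modulo_ker {V : Type*} [AddCommGroup V] [Module K V] (a : V →ₗ[K] W) :
    ∃ (g : V →ₗ[K] LinearMap.ker a) (Q : W →ₗ[K] V), (∀ v : LinearMap.ker a, g v = v) ∧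
      ∀ v, Q (a v) = v - g v := by
  obtain ⟨g, hg⟩ := LinearMap.exists_leftInverse_of_injective (LinearMap.ker a).subtype
    (Submodule.ker_subtype _)
  obtain ⟨s, hs⟩ := LinearMap.exists_rightInverse_of_surjective a.rangeRestrict
    a.range_rangeRestrict
  obtain ⟨Q, hQ⟩ := LinearMap.exists_extend
    ((LinearMap.id - (LinearMap.ker a).subtype ∘ₗ g) ∘ₗ s)
  have hg' (v : LinearMap.ker a) : g v = v := LinearMap.congr_fun hg v
  refine ⟨g, Q, hg', fun v => ?_⟩
  have hker : s (a.rangeRestrict v) - v ∈ LinearMap.ker a := by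
    have := congrArg Subtype.val (LinearMap.congr_fun hs (a.rangeRestrict v))
    rw [LinearMap.mem_ker, map_sub, sub_eq_zero]
    exact this
  have h1 : Q (a v) = s (a.rangeRestrict v) - g (s (a.rangeRestrict v)) :=
    LinearMap.congr_fun hQ (a.rangeRestrict v)
  have h2 := congrArg Subtype.val (hg' ⟨_, hker⟩)
  simp only [map_sub, Submodule.coe_sub] at h2
  rw [h1, sub_eq_sub_iff_sub_eq_sub, ← h2]

/-- A vector in the kernel of `a` extends to a polynomial family of vectors in the kernels of
`a + t • b`, for all those `t` outside a finite set for which the dimension does not drop. -/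
theorem exists_polynomial_mem_ker_add_smul (a b : (ι → K) →ₗ[K] W) {v₀ : ι → K} (hv₀ : a v₀ = 0) :
    ∃ (p : ι → K[X]) (d : K[X]), d ≠ 0 ∧ (∀ i, (p i).eval 0 = v₀ i) ∧
      ∀ t, d.eval t ≠ 0 →
        Module.finrank K (LinearMap.ker (a + t • b)) = Module.finrank K (LinearMap.ker a) →
        (a + t • b) (fun i => (p i).eval t) = 0 := by
  obtain ⟨g, Q, hg, hQ⟩ := exists_leftInverse_modulo_ker a
  let M : Matrix ι ι K := LinearMap.toMatrix' (Q ∘ₗ b)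
  let A : Matrix ι ι K[X] := 1 + (X : K[X]) • M.map C
  have hA (t : K) : (evalRingHom t).mapMatrix A = 1 + t • M := by
    ext i j
    simp [A, Matrix.one_apply, apply_ite (eval t), mul_comm t]
  have hdet (t : K) : A.det.eval t = (1 + t • M).det := by
    rw [← hA, ← RingHom.map_det, coe_evalRingHom]
  have hp (t : K) : (fun i => ((A.adjugate *ᵥ fun i => C (v₀ i)) i).eval t) =
      (1 + t • M).adjugate *ᵥ v₀ := by
    rw [← hA, ← RingHom.map_adjugate]
    ext i
    simp [Matrix.mulVec, dotProduct, eval_finsetSum]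
  refine ⟨A.adjugate *ᵥ fun i => C (v₀ i), A.det, fun h => ?_, fun i => ?_, fun t ht hrank => ?_⟩
  · have := hdet 0
    simp [h] at this
  · exact (congrFun (hp 0) i).trans (by simp)
  · have hC {v : ι → K} (hv : (a + t • b) v = 0) : (1 + t • M) *ᵥ v = g v := by
      have h1 : a v = -(t • b v) := eq_neg_of_add_eq_zero_left hv
      have h2 := hQ v
      rw [h1, map_neg, map_smul, neg_eq_iff_eq_neg] at h2
      rw [Matrix.add_mulVec, Matrix.one_mulVec, Matrix.smul_mulVec, LinearMap.toMatrix'_mulVec,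
        LinearMap.comp_apply, h2]
      abel
    have hinj : Function.Injective (g ∘ₗ (LinearMap.ker (a + t • b)).subtype) := by
      rw [← LinearMap.ker_eq_bot, LinearMap.ker_eq_bot']
      rintro ⟨v, hv⟩ h
      have h1 := hC hv
      rw [show g v = 0 from h, Submodule.coe_zero] at h1
      exact Subtype.ext (Matrix.eq_zero_of_mulVec_eq_zero (by rwa [← hdet]) h1)
    obtain ⟨⟨v, hv⟩, hgv⟩ :=
      (LinearMap.injective_iff_surjective_of_finrank_eq_finrank hrank).1 hinj ⟨v₀, hv₀⟩
    have hgv' : (g v : ι → K) = v₀ := congrArg Subtype.val hgv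
    rw [hp, ← hgv', ← hC hv, Matrix.mulVec_mulVec, Matrix.adjugate_mul, Matrix.smul_mulVec,
      Matrix.one_mulVec, map_smul, show (a + t • b) v = 0 from hv, smul_zero]

end KernelPencil

section CommutingCurve

variable {n m : ℕ} {K : Type*} [Field K]

/-- The commutator with `X`, paired with `c` times the lower triangular part, as a linear map on
uncurried matrices. For `c = 1` its kernel is the centralizer of `X` among the strictly upper
triangular matrices. -/
def commutatorMap (X : Matrix (Fin n) (Fin n) K) (c : K) :
    (Fin n × Fin n → K) →ₗ[K] Matrix (Fin n) (Fin n) K × (Fin n → Fin n → K) where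
  toFun y := (X * Matrix.of (Function.curry y) - Matrix.of (Function.curry y) * X,
    fun i j => if j ≤ i then c * y (i, j) else 0)
  map_add' y z := by
    have : Matrix.of (Function.curry (y + z)) =
      Matrix.of (Function.curry y) + Matrix.of (Function.curry z) := rfl
    refine Prod.ext ?_ ?_
    · simp only [this, mul_add, add_mul, Prod.fst_add]
      abel
    · ext i j
      by_cases h : j ≤ i <;> simp [h, mul_add]
  map_smul' r y := by
    have : Matrix.of (Function.curry (r • y)) = r • Matrix.of (Function.curry y) := rfl
    refine Prod.ext ?_ ?_
    · simp only [this, Matrix.mul_smul, Matrix.smul_mul, ← smul_sub]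
      rfl
    · ext i j
      by_cases h : j ≤ i <;> simp [h, mul_left_comm]

theorem commutatorMap_add_smul (X D : Matrix (Fin n) (Fin n) K) (t : K) :
    commutatorMap X 1 + t • commutatorMap D 0 = commutatorMap (X + t • D) 1 := by
  ext y : 1
  refine LinearMap.ext fun r => Prod.ext ?_ ?_
  · simp [commutatorMap, add_mul, mul_add, smul_sub]
    abel
  · ext i j
    simp [commutatorMap]

theorem commutatorMap_eq_zero_iff {X : Matrix (Fin n) (Fin n) K} {y : Fin n × Fin n → K} :
    commutatorMap X 1 y = 0 ↔ IsSUT (Matrix.of (Function.curry y)) ∧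
      X * Matrix.of (Function.curry y) = Matrix.of (Function.curry y) * X := by
  simp [commutatorMap, Prod.ext_iff, sub_eq_zero, funext_iff, IsSUT, and_comm]

theorem finrank_ker_commutatorMap (X : Matrix (Fin n) (Fin n) K) :
    Module.finrank K (LinearMap.ker (commutatorMap X 1)) = Module.finrank K
      ↥(sutSub n K ⊓ LinearMap.ker (LinearMap.mulLeft K X - LinearMap.mulRight K X)) := by
  let e : (Fin n × Fin n → K) ≃ₗ[K] Matrix (Fin n) (Fin n) K :=
    (LinearEquiv.curry K K (Fin n) (Fin n)).trans (Matrix.ofLinearEquiv K)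
  have : LinearMap.ker (commutatorMap X 1) = (sutSub n K ⊓
      LinearMap.ker (LinearMap.mulLeft K X - LinearMap.mulRight K X)).comap e.toLinearMap := by
    ext y
    rw [LinearMap.mem_ker, commutatorMap_eq_zero_iff, Submodule.mem_comap, mem_sutSub_inf_ker_iff]
    rfl
  rw [this]
  exact (e.ofSubmodule' _).finrank_eq

/-- A commuting pair of strictly upper triangular matrices with `X₀` regular lies on a polynomial
curve of commuting pairs `(X, Y)` such that the first rows of the powers of `X` are independent
for all but finitely many parameters. -/
theorem exists_commuting_curve {X₀ Y₀ : Matrix (Fin (m + 1)) (Fin (m + 1)) K} (hX₀ : regU X₀)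
    (hY₀ : IsSUT Y₀) (hcomm : X₀ * Y₀ = Y₀ * X₀) :
    ∃ (P Q : Matrix (Fin (m + 1)) (Fin (m + 1)) K[X]) (d : K[X]), d ≠ 0 ∧
      P.map (eval 0) = X₀ ∧ Q.map (eval 0) = Y₀ ∧ ∀ t, d.eval t ≠ 0 →
        IsSUT (P.map (eval t)) ∧ IsSUT (Q.map (eval t)) ∧ (firstRows (P.map (eval t))).det ≠ 0 ∧
        P.map (eval t) * Q.map (eval t) = Q.map (eval t) * P.map (eval t) := by
  set D := shiftMatrix (m + 1) K - X₀ with hD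
  let P : Matrix (Fin (m + 1)) (Fin (m + 1)) K[X] := X₀.map C + (X : K[X]) • D.map C
  have hP (t : K) : P.map (eval t) = X₀ + t • D := by
    ext i j
    simp [P, mul_comm t]
  have hdet (t : K) : (firstRows P).det.eval t = (firstRows (P.map (eval t))).det := by
    have h := firstRows_map (evalRingHom t) P
    rw [← coe_evalRingHom, RingHom.map_det, ← h]
    rfl
  have hSUT (t : K) : IsSUT (X₀ + t • D) := fun i j hij => by
    simp [hD, hX₀.1 i j hij, isSUT_shiftMatrix i j hij]
  obtain ⟨q, d, hd, hq0, hq⟩ := exists_polynomial_mem_ker_add_smul (commutatorMap X₀ 1)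
    (commutatorMap D 0) (v₀ := Function.uncurry Y₀) (commutatorMap_eq_zero_iff.2 ⟨hY₀, hcomm⟩)
  refine ⟨P, Matrix.of (Function.curry q), d * (firstRows P).det,
    mul_ne_zero hd fun h => ?_, ?_, ?_, fun t ht => ?_⟩
  · have := hdet 1
    rw [hP, one_smul, hD, add_sub_cancel, firstRows_shiftMatrix, h] at this
    simp at this
  · simp [hP]
  · ext i j
    exact hq0 (i, j)
  · rw [eval_mul, mul_ne_zero_iff, hdet, hP] at ht
    have h := hq t ht.1 (by
      rw [commutatorMap_add_smul, finrank_ker_commutatorMap, finrank_ker_commutatorMap, hX₀.2,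
        (regU_of_det_firstRows_ne_zero (hSUT t) ht.2).2])
    rw [commutatorMap_add_smul, commutatorMap_eq_zero_iff] at h
    rw [hP]
    exact ⟨hSUT t, h.1, ht.2, h.2⟩

end CommutingCurve

section ZariskiTopology

variable {n : ℕ} {K : Type*} [Field K]

theorem isTopologicalBasis_ptTop :
    TopologicalSpace.IsTopologicalBasis
      { U : Set (Pt n K) | ∃ p : MvPolynomial ((Fin n × Fin n) ⊕ (Fin n × Fin n)) K,
        U = {x | MvPolynomial.eval x p ≠ 0} } where
  exists_subset_inter := by
    rintro _ ⟨p, rfl⟩ _ ⟨q, rfl⟩ x hx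
    exact ⟨_, ⟨p * q, rfl⟩, by simpa using hx, fun y hy => by simpa using hy⟩
  sUnion_eq := Set.eq_univ_of_forall fun x => ⟨_, ⟨1, rfl⟩, by simp⟩
  eq_generateFrom := rfl

theorem closure_eq_zeroLocus (S : Set (Pt n K)) :
    closure S = MvPolynomial.zeroLocus K (MvPolynomial.vanishingIdeal K S) := by
  ext x
  rw [isTopologicalBasis_ptTop.mem_closure_iff]
  constructor
  · intro h p hp
    by_contra hx
    obtain ⟨y, hy, hyS⟩ := h _ ⟨p, rfl⟩ (by simpa [MvPolynomial.coe_aeval_eq_eval] using hx)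
    exact hy (by simpa [MvPolynomial.coe_aeval_eq_eval] using hp y hyS)
  · rintro h _ ⟨p, rfl⟩ hx
    by_contra hne
    refine hx ?_
    have := h p fun y hy => by
      by_contra hyp
      exact hne ⟨y, by simpa [MvPolynomial.coe_aeval_eq_eval] using hyp, hy⟩
    simpa [MvPolynomial.coe_aeval_eq_eval] using this

theorem isClosed_zeroLocus (I : Ideal (MvPolynomial ((Fin n × Fin n) ⊕ (Fin n × Fin n)) K)) :
    IsClosed (MvPolynomial.zeroLocus K I : Set (Pt n K)) := by
  rw [← closure_subset_iff_isClosed, closure_eq_zeroLocus]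
  exact MvPolynomial.zeroLocus_anti_mono (MvPolynomial.le_vanishingIdeal_zeroLocus I)

theorem isIrreducible_iff_isPrime_vanishingIdeal (S : Set (Pt n K)) :
    IsIrreducible S ↔ (MvPolynomial.vanishingIdeal K S).IsPrime := by
  have hmem (p : MvPolynomial ((Fin n × Fin n) ⊕ (Fin n × Fin n)) K) :
      p ∉ MvPolynomial.vanishingIdeal K S ↔ (S ∩ {x | MvPolynomial.eval x p ≠ 0}).Nonempty := by
    simp [Set.Nonempty]
  have hopen (p : MvPolynomial ((Fin n × Fin n) ⊕ (Fin n × Fin n)) K) :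
      IsOpen {x : Pt n K | MvPolynomial.eval x p ≠ 0} :=
    isTopologicalBasis_ptTop.isOpen ⟨p, rfl⟩
  constructor
  · rintro ⟨⟨x, hx⟩, hS⟩
    refine ⟨fun h => ?_, fun {p q} hpq => ?_⟩
    · have : (1 : MvPolynomial _ K) ∈ MvPolynomial.vanishingIdeal K S := h ▸ trivial
      simpa using this x hx
    · contrapose! hpq
      rw [hmem] at hpq ⊢
      rw [hmem] at hpq
      obtain ⟨y, hyS, hy⟩ := hS _ _ (hopen p) (hopen q) hpq.1 hpq.2
      exact ⟨y, hyS, by simpa using hy⟩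
  · intro hI
    refine ⟨?_, ?_⟩
    · obtain ⟨x, hx, -⟩ := (hmem 1).1 fun h => hI.ne_top ((Ideal.eq_top_iff_one _).2 h)
      exact ⟨x, hx⟩
    · rintro u v hu hv ⟨x, hxS, hxu⟩ ⟨y, hyS, hyv⟩
      obtain ⟨_, ⟨p, rfl⟩, hxp, hpu⟩ := isTopologicalBasis_ptTop.exists_subset_of_mem_open hxu hu
      obtain ⟨_, ⟨q, rfl⟩, hyq, hqv⟩ := isTopologicalBasis_ptTop.exists_subset_of_mem_open hyv hv
      have hpq : p * q ∉ MvPolynomial.vanishingIdeal K S := fun h =>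
        (hI.mem_or_mem h).elim ((hmem p).2 ⟨x, hxS, hxp⟩) ((hmem q).2 ⟨y, hyS, hyq⟩)
      obtain ⟨z, hzS, hz⟩ := (hmem _).1 hpq
      have hz' : MvPolynomial.eval z p ≠ 0 ∧ MvPolynomial.eval z q ≠ 0 := by simpa using hz
      exact ⟨z, hzS, hpu hz'.1, hqv hz'.2⟩

/-- Restricting an irreducible subset to a subspace containing it preserves irreducibility. -/
theorem IsIrreducible.preimage_subtypeVal {X : Type*} [TopologicalSpace X] {Z S : Set X}
    (hS : IsIrreducible S) (hSZ : S ⊆ Z) : IsIrreducible (Subtype.val ⁻¹' S : Set Z) := by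
  obtain ⟨⟨x, hx⟩, hpre⟩ := hS
  refine ⟨⟨⟨x, hSZ hx⟩, hx⟩, ?_⟩
  rintro _ _ ⟨u, hu, rfl⟩ ⟨v, hv, rfl⟩ ⟨y, hyS, hyu⟩ ⟨z, hzS, hzv⟩
  obtain ⟨w, hwS, hw⟩ := hpre u v hu hv ⟨y, hyS, hyu⟩ ⟨z, hzS, hzv⟩
  exact ⟨⟨w, hSZ hwS⟩, hwS, hw⟩

theorem topologicalKrullDim_eq_ringKrullDim [IsAlgClosed K] {Z : Set (Pt n K)} (hZ : IsClosed Z) :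
    topologicalKrullDim Z =
      ringKrullDim (MvPolynomial ((Fin n × Fin n) ⊕ (Fin n × Fin n)) K ⧸
        MvPolynomial.vanishingIdeal K Z) := by
  have hZcl : MvPolynomial.zeroLocus K (MvPolynomial.vanishingIdeal K Z) = Z := by
    rw [← closure_eq_zeroLocus, hZ.closure_eq]
  rw [ringKrullDim, Order.krullDim_eq_of_orderIso
    (Ideal.primeSpectrumQuotientOrderIsoZeroLocus (MvPolynomial.vanishingIdeal K Z)),
    ← Order.krullDim_orderDual, topologicalKrullDim]
  apply le_antisymm
  · let F (W : TopologicalSpace.IrreducibleCloseds Z) :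
        (PrimeSpectrum.zeroLocus (MvPolynomial.vanishingIdeal K Z :
          Set (MvPolynomial ((Fin n × Fin n) ⊕ (Fin n × Fin n)) K)))ᵒᵈ :=
      OrderDual.toDual ⟨⟨MvPolynomial.vanishingIdeal K (Subtype.val '' (W : Set Z)),
        (isIrreducible_iff_isPrime_vanishingIdeal _).1
          (W.isIrreducible.image _ continuous_subtype_val.continuousOn)⟩,
        MvPolynomial.vanishingIdeal_anti_mono (Subtype.coe_image_subset Z _)⟩
    refine Order.krullDim_le_of_strictMono F (Monotone.strictMono_of_injective ?_ ?_)
    · exact fun V W h => MvPolynomial.vanishingIdeal_anti_mono (Set.image_mono h)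
    · intro V W h
      have h' : MvPolynomial.vanishingIdeal K (Subtype.val '' (V : Set Z)) =
          MvPolynomial.vanishingIdeal K (Subtype.val '' (W : Set Z)) :=
        congrArg (fun p => (OrderDual.ofDual p).1.asIdeal) h
      have hcl (W : TopologicalSpace.IrreducibleCloseds Z) :
          MvPolynomial.zeroLocus K (MvPolynomial.vanishingIdeal K
            (Subtype.val '' (W : Set Z) : Set (Pt n K))) = Subtype.val '' (W : Set Z) := by
        rw [← closure_eq_zeroLocus]
        exact (hZ.isClosedEmbedding_subtypeVal.isClosedMap _ W.isClosed).closure_eq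
      refine TopologicalSpace.IrreducibleCloseds.ext
        (Subtype.val_injective.image_injective ?_)
      rw [← hcl V, h', hcl W]
  · have hsub (p : (PrimeSpectrum.zeroLocus (MvPolynomial.vanishingIdeal K Z :
          Set (MvPolynomial ((Fin n × Fin n) ⊕ (Fin n × Fin n)) K)))ᵒᵈ) :
        MvPolynomial.zeroLocus K p.ofDual.1.asIdeal ⊆ Z :=
      (MvPolynomial.zeroLocus_anti_mono p.ofDual.2).trans hZcl.le
    let G (p : (PrimeSpectrum.zeroLocus (MvPolynomial.vanishingIdeal K Z :
          Set (MvPolynomial ((Fin n × Fin n) ⊕ (Fin n × Fin n)) K)))ᵒᵈ) :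
        TopologicalSpace.IrreducibleCloseds Z :=
      { carrier := Subtype.val ⁻¹' (MvPolynomial.zeroLocus K p.ofDual.1.asIdeal)
        isIrreducible' := by
          have := p.ofDual.1.isPrime
          refine IsIrreducible.preimage_subtypeVal
            ((isIrreducible_iff_isPrime_vanishingIdeal _).2 ?_) (hsub p)
          rwa [MvPolynomial.IsPrime.vanishingIdeal_zeroLocus]
        isClosed' := (isClosed_zeroLocus _).preimage continuous_subtype_val }
    have hG (p) : Subtype.val '' (G p : Set Z) =
        MvPolynomial.zeroLocus K p.ofDual.1.asIdeal :=
      (Subtype.image_preimage_coe Z _).trans (Set.inter_eq_right.2 (hsub p))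
    refine Order.krullDim_le_of_strictMono G (Monotone.strictMono_of_injective ?_ ?_)
    · intro p q h
      have h' : q.ofDual.1.asIdeal ≤ p.ofDual.1.asIdeal := h
      exact Set.preimage_mono (f := Subtype.val) (MvPolynomial.zeroLocus_anti_mono h')
    · intro p q h
      have h' : MvPolynomial.zeroLocus K p.ofDual.1.asIdeal =
          MvPolynomial.zeroLocus K q.ofDual.1.asIdeal := by
        rw [← hG p, ← hG q, h]
      have hp := p.ofDual.1.isPrime
      have hq := q.ofDual.1.isPrime
      refine OrderDual.ofDual.injective (Subtype.ext (PrimeSpectrum.ext ?_))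
      rw [← MvPolynomial.IsPrime.vanishingIdeal_zeroLocus (K := K) p.ofDual.1.asIdeal, h',
        MvPolynomial.IsPrime.vanishingIdeal_zeroLocus]

end ZariskiTopology

section Parametrization

variable {m : ℕ} {R S K : Type*} [CommRing R] [CommRing S] [Field K]

/-- Indices for the entries above the diagonal of a square matrix of size `m + 1` together with
the coefficients of a polynomial of degree `m` without constant term. -/
abbrev ParamIdx (m : ℕ) := {p : Fin (m + 1) × Fin (m + 1) // p.1 < p.2} ⊕ Fin m

/-- The strictly upper triangular matrix with the given entries. -/
def paramMatrix (a : ParamIdx m → R) : Matrix (Fin (m + 1)) (Fin (m + 1)) R :=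
  Matrix.of fun i j => if h : i < j then a (Sum.inl ⟨(i, j), h⟩) else 0

/-- The pair consisting of a strictly upper triangular matrix and a polynomial in it. -/
def paramPt (a : ParamIdx m → R) : Pt (m + 1) R :=
  Sum.elim (Function.uncurry (paramMatrix a))
    (Function.uncurry (polyOf (fun k => a (Sum.inr k)) (paramMatrix a)))

theorem isSUT_paramMatrix (a : ParamIdx m → R) : IsSUT (paramMatrix a) :=
  fun _ _ hij => dif_neg hij.not_gt

theorem Xof_paramPt (a : ParamIdx m → R) : Xof (paramPt a) = paramMatrix a := rfl

theorem Yof_paramPt (a : ParamIdx m → R) :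
    Yof (paramPt a) = polyOf (fun k => a (Sum.inr k)) (paramMatrix a) := rfl

theorem paramMatrix_comp (f : R →+* S) (a : ParamIdx m → R) :
    paramMatrix (f ∘ a) = f.mapMatrix (paramMatrix a) := by
  ext i j
  by_cases h : i < j <;> simp [paramMatrix, h]

theorem paramPt_comp (f : R →+* S) (a : ParamIdx m → R) :
    paramPt (f ∘ a) = f ∘ paramPt a := by
  funext i
  rcases i with ⟨i, j⟩ | ⟨i, j⟩
  · exact congrFun (congrFun (paramMatrix_comp f a) i) j
  · have h := polyOf_map f (fun k => a (Sum.inr k)) (paramMatrix a)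
    rw [← paramMatrix_comp] at h
    exact congrFun (congrFun h i) j

theorem paramMatrix_entries {X : Matrix (Fin (m + 1)) (Fin (m + 1)) R} (hX : IsSUT X)
    (c : Fin m → R) :
    paramMatrix (Sum.elim (fun p => X p.1.1 p.1.2) c : ParamIdx m → R) = X := by
  ext i j
  by_cases h : i < j
  · simp [paramMatrix, h]
  · simp [paramMatrix, h, hX i j (not_lt.1 h)]

theorem mem_range_paramPt {x : Pt (m + 1) K} (hX : IsSUT (Xof x)) (hY : IsSUT (Yof x))
    (hdet : (firstRows (Xof x)).det ≠ 0) (hXY : Xof x * Yof x = Yof x * Xof x) :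
    x ∈ Set.range (paramPt (m := m) (R := K)) := by
  obtain ⟨c, hc⟩ := exists_eq_polyOf hX hY hdet hXY
  refine ⟨Sum.elim (fun p => Xof x p.1.1 p.1.2) c, funext fun i => ?_⟩
  have hX' := paramMatrix_entries hX c
  rcases i with ⟨i, j⟩ | ⟨i, j⟩
  · exact congrFun (congrFun hX' i) j
  · change polyOf c (paramMatrix _) i j = _
    rw [hX', ← hc]
    rfl

/-- The universal parametrized pair. -/
noncomputable def genericPt (m : ℕ) (K : Type*) [Field K] :
    Pt (m + 1) (MvPolynomial (ParamIdx m) K) :=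
  paramPt MvPolynomial.X

theorem eval_aeval_genericPt (p : MvPolynomial _ K) (a : ParamIdx m → K) :
    MvPolynomial.eval a (MvPolynomial.aeval (genericPt m K) p) =
      MvPolynomial.eval (paramPt a) p := by
  have h : paramPt a = MvPolynomial.eval a ∘ genericPt m K := by
    rw [genericPt, ← paramPt_comp]
    congr 1
    ext i
    simp
  rw [h, ← MvPolynomial.coe_aeval_eq_eval, ← MvPolynomial.coe_aeval_eq_eval]
  exact MvPolynomial.comp_aeval_apply _ (MvPolynomial.aeval a) p

theorem eval_det_firstRows_Xof (a : ParamIdx m → K) :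
    MvPolynomial.eval a (firstRows (Xof (genericPt m K))).det =
      (firstRows (Xof (paramPt a))).det := by
  have h : Xof (paramPt a) = (MvPolynomial.eval a).mapMatrix (Xof (genericPt m K)) := by
    rw [Xof_paramPt, genericPt, Xof_paramPt, ← paramMatrix_comp]
    congr 1
    ext i
    simp
  rw [h, firstRows_map, RingHom.map_det]

theorem eval_det_firstRows_Yof (a : ParamIdx m → K) :
    MvPolynomial.eval a (firstRows (Yof (genericPt m K))).det =
      (firstRows (Yof (paramPt a))).det := by
  have h : Yof (paramPt a) = (MvPolynomial.eval a).mapMatrix (Yof (genericPt m K)) := by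
    rw [Yof_paramPt, genericPt, Yof_paramPt, ← polyOf_map, ← paramMatrix_comp]
    have : MvPolynomial.eval a ∘ MvPolynomial.X = a := by
      ext i
      simp
    rw [this]
    congr 1
    ext i
    simp
  rw [h, firstRows_map, RingHom.map_det]

theorem exists_paramPt_eq_shiftMatrix : ∃ a : ParamIdx m → K,
    Xof (paramPt a) = shiftMatrix (m + 1) K ∧ Yof (paramPt a) = shiftMatrix (m + 1) K := by
  obtain ⟨c, hc⟩ := exists_polyOf_shiftMatrix_eq (m := m) (R := K)
  refine ⟨Sum.elim (fun p => shiftMatrix (m + 1) K p.1.1 p.1.2) c, ?_, ?_⟩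
  · exact paramMatrix_entries isSUT_shiftMatrix c
  · rw [Yof_paramPt, paramMatrix_entries isSUT_shiftMatrix c]
    exact hc

theorem det_firstRows_Xof_genericPt_ne_zero : (firstRows (Xof (genericPt m K))).det ≠ 0 := by
  obtain ⟨a, ha, -⟩ := exists_paramPt_eq_shiftMatrix (m := m) (K := K)
  intro h
  have := eval_det_firstRows_Xof a
  rw [h, ha, firstRows_shiftMatrix] at this
  simp at this

theorem det_firstRows_Yof_genericPt_ne_zero : (firstRows (Yof (genericPt m K))).det ≠ 0 := by
  obtain ⟨a, -, ha⟩ := exists_paramPt_eq_shiftMatrix (m := m) (K := K)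
  intro h
  have := eval_det_firstRows_Yof a
  rw [h, ha, firstRows_shiftMatrix] at this
  simp at this

theorem vanishingIdeal_NT0 [Infinite K] :
    MvPolynomial.vanishingIdeal K (NT0 (m + 1) K) =
      RingHom.ker (MvPolynomial.aeval (R := K) (genericPt m K)) := by
  rw [NT0, closure_eq_zeroLocus]
  ext p
  rw [RingHom.mem_ker]
  constructor
  · intro hp
    replace hp : p ∈ MvPolynomial.vanishingIdeal K _ :=
      MvPolynomial.vanishingIdeal_anti_mono (MvPolynomial.zeroLocus_vanishingIdeal_le _) hp
    have hmul : MvPolynomial.aeval (genericPt m K) p *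
        ((firstRows (Xof (genericPt m K))).det * (firstRows (Yof (genericPt m K))).det) = 0 := by
      refine MvPolynomial.funext fun a => ?_
      rw [map_mul, map_mul, eval_det_firstRows_Xof, eval_det_firstRows_Yof, eval_aeval_genericPt,
        map_zero]
      by_contra hne
      simp only [mul_ne_zero_iff, ← ne_eq] at hne
      obtain ⟨hpa, hXa, hYa⟩ := hne
      have hX := isSUT_paramMatrix a
      have hY := isSUT_polyOf (fun k => a (Sum.inr k)) hX
      exact hpa (hp _ ⟨⟨hX, hY, mul_polyOf _ _⟩, regU_of_det_firstRows_ne_zero hX hXa,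
        regU_of_det_firstRows_ne_zero hY hYa⟩)
    exact (mul_eq_zero.1 hmul).resolve_right
      (mul_ne_zero det_firstRows_Xof_genericPt_ne_zero det_firstRows_Yof_genericPt_ne_zero)
  · intro hp
    refine MvPolynomial.le_vanishingIdeal_zeroLocus _ ?_
    rintro x ⟨⟨-, hY, hXY⟩, hX, -⟩
    obtain ⟨P, Q, d, hd, hP, hQ, hPQ⟩ := exists_commuting_curve hX hY hXY
    let γ : Pt (m + 1) K[X] := Sum.elim (Function.uncurry P) (Function.uncurry Q)
    have hγ (t : K) (f : MvPolynomial _ K) : (MvPolynomial.aeval γ f).eval t =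
        MvPolynomial.eval (fun i => (γ i).eval t) f := by
      rw [← coe_aeval_eq_eval, ← MvPolynomial.coe_aeval_eq_eval]
      exact MvPolynomial.comp_aeval_apply _ (aeval t) f
    have hzero : MvPolynomial.aeval γ p * d = 0 := by
      refine Polynomial.funext fun t => ?_
      rw [eval_mul, eval_zero, mul_eq_zero, or_iff_not_imp_right, hγ]
      intro ht
      obtain ⟨h1, h2, h3, h4⟩ := hPQ t ht
      obtain ⟨a, ha⟩ := mem_range_paramPt (x := fun i => (γ i).eval t) h1 h2 h3 h4
      rw [← ha, ← eval_aeval_genericPt, hp, map_zero]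
    have hx : (fun i => (γ i).eval 0) = x := by
      funext i
      rcases i with ⟨i, j⟩ | ⟨i, j⟩
      · exact congrFun (congrFun hP i) j
      · exact congrFun (congrFun hQ i) j
    have h0 := hγ 0 p
    rw [(mul_eq_zero.1 hzero).resolve_right hd, hx, eval_zero] at h0
    exact (RingHom.congr_fun (MvPolynomial.coe_aeval_eq_eval x) p).trans h0.symm

end Parametrization

/-- An integral injective extension of commutative rings preserves the Krull dimension. -/
theorem ringKrullDim_eq_of_isIntegral_of_faithfulSMul (R S : Type*) [CommRing R] [CommRing S]
    [Algebra R S] [Algebra.IsIntegral R S] [FaithfulSMul R S] :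
    ringKrullDim S = ringKrullDim R := by
  refine le_antisymm (Order.krullDim_le_of_strictMono (PrimeSpectrum.comap (algebraMap R S))
    fun _ _ h => Ideal.IsIntegral.comap_lt_comap h) (iSup_le fun l => ?_)
  obtain ⟨⟨P, hP, hPl⟩⟩ := Ideal.nonempty_primesOver (S := S) l.head.asIdeal
  obtain ⟨L, hL, -⟩ := Ideal.exists_ltSeries_of_hasGoingUp l P
  exact hL ▸ Order.LTSeries.length_le_krullDim L

/-- The Krull dimension of a finitely generated domain over a field is its transcendence
degree. -/
theorem ringKrullDim_eq_of_trdeg_eq (K A : Type*) [Field K] [CommRing A] [IsDomain A]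
    [Algebra K A] [Algebra.FiniteType K A] (m : ℕ) (h : Algebra.trdeg K A = m) :
    ringKrullDim A = m := by
  obtain ⟨s, g, hg, hfin⟩ := exists_finite_inj_algHom_of_fg K A
  algebraize [g.toRingHom]
  have : Module.Finite (MvPolynomial (Fin s) K) A := hfin
  have : FaithfulSMul (MvPolynomial (Fin s) K) A := (faithfulSMul_iff_algebraMap_injective _ _).2 hg
  have : IsScalarTower K (MvPolynomial (Fin s) K) A :=
    .of_algebraMap_eq fun x => (g.commutes x).symm
  have key := lift_trdeg_add_eq K (MvPolynomial (Fin s) K) A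
  rw [trdeg_eq_zero (R := MvPolynomial (Fin s) K) (A := A), h] at key
  simp at key
  rw [ringKrullDim_eq_of_isIntegral_of_faithfulSMul (MvPolynomial (Fin s) K) A,
    MvPolynomial.ringKrullDim_of_isNoetherianRing]
  simpa using key

section Dimension

/-- The Krull dimension of the image of `f`, when the target is algebraic over it. -/
theorem ringKrullDim_quotient_ker_eq {K A B : Type*} [Field K] [CommRing A] [CommRing B]
    [IsDomain B] [Algebra K A] [Algebra K B] [Algebra.FiniteType K A] (f : A →ₐ[K] B)
    [Algebra.IsAlgebraic f.range B] (d : ℕ) (hd : Algebra.trdeg K B = d) :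
    ringKrullDim (A ⧸ RingHom.ker f) = d := by
  refine (ringKrullDim_eq_of_ringEquiv (RingHom.quotientKerEquivRange (f : A →+* B))).trans ?_
  have : Algebra.FiniteType K f.range := .of_surjective f.rangeRestrict f.rangeRestrict_surjective
  refine ringKrullDim_eq_of_trdeg_eq K f.range d ?_
  have key := trdeg_add_eq K f.range (A := B)
  rwa [trdeg_eq_zero (R := f.range) (A := B), add_zero, hd] at key

theorem card_paramIdx (m : ℕ) : Fintype.card (ParamIdx m) = (m + 1) * (m + 1 + 1) / 2 - 1 := by
  have h : Fintype.card {p : Fin (m + 1) × Fin (m + 1) // p.1 < p.2} = (m + 1) * m / 2 := by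
    rw [Fintype.card_subtype, Finset.card_filter, Fintype.sum_prod_type_right]
    simp only [← Finset.card_filter, Finset.filter_gt_eq_Iio, Fin.card_Iio]
    rw [Fin.sum_univ_eq_sum_range (fun i => i), Finset.sum_range_id, Nat.add_sub_cancel]
  rw [Fintype.card_sum, h, Fintype.card_fin,
    show (m + 1) * (m + 1 + 1) = (m + 1) * m + (m + 1) * 2 by ring,
    Nat.add_mul_div_right _ _ two_pos]
  omega

variable {m : ℕ} {K : Type*} [Field K]

theorem genericPt_mem_range (i) :
    genericPt m K i ∈ (MvPolynomial.aeval (R := K) (genericPt m K)).range :=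
  ⟨MvPolynomial.X i, MvPolynomial.aeval_X _ _⟩

theorem isAlgebraic_X_inl (p) :
    IsAlgebraic (MvPolynomial.aeval (R := K) (genericPt m K)).range
      (MvPolynomial.X (Sum.inl p) : MvPolynomial (ParamIdx m) K) := by
  have h : genericPt m K (Sum.inl p.1) = MvPolynomial.X (Sum.inl p) := dif_pos p.2
  rw [← h]
  exact isAlgebraic_algebraMap (A := MvPolynomial (ParamIdx m) K)
    (⟨_, genericPt_mem_range (Sum.inl p.1)⟩ : (MvPolynomial.aeval (R := K) (genericPt m K)).range)

theorem isAlgebraic_X_inr (k) :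
    IsAlgebraic (MvPolynomial.aeval (R := K) (genericPt m K)).range
      (MvPolynomial.X (Sum.inr k) : MvPolynomial (ParamIdx m) K) := by
  set A := (MvPolynomial.aeval (R := K) (genericPt m K)).range
  let x : Pt (m + 1) A := fun i => ⟨genericPt m K i, genericPt_mem_range i⟩
  have hdet : (firstRows (Xof (genericPt m K))).det = algebraMap A _ (firstRows (Xof x)).det := by
    rw [RingHom.map_det, ← firstRows_map]
    rfl
  refine IsAlgebraic.of_mul (mem_nonZeroDivisors_of_ne_zero det_firstRows_Xof_genericPt_ne_zero)
    (hdet ▸ isAlgebraic_algebraMap _) ?_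
  have hrow : (fun j : Fin m => Yof (genericPt m K) 0 j.succ) =
      (fun k => MvPolynomial.X (Sum.inr k)) ᵥ* firstRows (Xof (genericPt m K)) :=
    funext fun j => polyOf_zero_succ _ _ j
  have hsolve := congrFun (congrArg (· ᵥ* (firstRows (Xof (genericPt m K))).adjugate) hrow) k
  simp only [Matrix.vecMul_vecMul, Matrix.mul_adjugate, Matrix.vecMul_smul, Matrix.vecMul_one,
    Pi.smul_apply, smul_eq_mul] at hsolve
  rw [← hsolve]
  have hval : ((fun j : Fin m => Yof (genericPt m K) 0 j.succ) ᵥ*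
      (firstRows (Xof (genericPt m K))).adjugate) k = algebraMap A _
        (((fun j : Fin m => Yof x 0 j.succ) ᵥ* (firstRows (Xof x)).adjugate) k) := by
    rw [RingHom.map_vecMul, ← RingHom.mapMatrix_apply, RingHom.map_adjugate, ← firstRows_map]
    rfl
  rw [hval]
  exact isAlgebraic_algebraMap _

instance isAlgebraic_range_aeval_genericPt :
    Algebra.IsAlgebraic (MvPolynomial.aeval (R := K) (genericPt m K)).range
      (MvPolynomial (ParamIdx m) K) where
  isAlgebraic p := by
    induction p using MvPolynomial.induction_on with
    | C r =>
      exact isAlgebraic_algebraMap (A := MvPolynomial (ParamIdx m) K)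
        (algebraMap K (MvPolynomial.aeval (R := K) (genericPt m K)).range r)
    | add p q hp hq => exact hp.add hq
    | mul_X p i hp => exact hp.mul (i.rec isAlgebraic_X_inl isAlgebraic_X_inr)

theorem ringKrullDim_quotient_ker_aeval_genericPt :
    ringKrullDim (MvPolynomial _ K ⧸ RingHom.ker (MvPolynomial.aeval (R := K) (genericPt m K))) =
      ((m + 1) * (m + 1 + 1) / 2 - 1 : ℕ) := by
  refine ringKrullDim_quotient_ker_eq _ _ ?_
  rw [MvPolynomial.trdeg_of_isDomain, ← card_paramIdx]
  simp

end Dimension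

/-- `NT_n^0` is irreducible of dimension `n(n+1)/2 - 1`. -/
theorem stmt5 (n : ℕ) (K : Type*) [Field K] [IsAlgClosed K] (hn : 1 ≤ n) :
    IsIrreducible (NT0 n K) ∧
    topologicalKrullDim (NT0 n K) = ((n * (n + 1) / 2 - 1 : ℕ) : WithBot ℕ∞) := by
  obtain ⟨m, rfl⟩ := Nat.exists_eq_add_of_le' hn
  have : Infinite K := IsAlgClosed.instInfinite
  constructor
  · rw [isIrreducible_iff_isPrime_vanishingIdeal, vanishingIdeal_NT0]
    exact RingHom.ker_isPrime _
  · have hcl : IsClosed (NT0 (m + 1) K) := isClosed_closure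
    rw [topologicalKrullDim_eq_ringKrullDim hcl, vanishingIdeal_NT0]
    exact ringKrullDim_quotient_ker_aeval_genericPt
end

section
/- The variety V_{m,p,q} = {(A,B) ∈ M(m,p)×M(p,q) : AB = 0} has irreducible components V^{a,b} = {(A,B) : rank A ≤ a, rank B ≤ b} for pairs (a,b) maximal with b ≤ min{p,q} and a ≤ min{p-b, m}; each such component has dimension a(p+m-a) + b(p+q-b) - ab. -/
open Matrix

/-- Points of the affine space `M(m,p) × M(p,q)`. -/
abbrev PtV (m p q : ℕ) (K : Type*) := ((Fin m × Fin p) ⊕ (Fin p × Fin q)) → K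

/-- The Zariski topology on the affine space `M(m,p) × M(p,q)`. -/
noncomputable instance ptVTop (m p q : ℕ) (K : Type*) [CommRing K] :
    TopologicalSpace (PtV m p q K) :=
  TopologicalSpace.generateFrom
    { U | ∃ f : MvPolynomial ((Fin m × Fin p) ⊕ (Fin p × Fin q)) K,
        U = {x | MvPolynomial.eval x f ≠ 0} }

/-- The first matrix of the pair. -/
def Aof {m p q : ℕ} {K : Type*} (x : PtV m p q K) : Matrix (Fin m) (Fin p) K :=
  Matrix.of fun i j => x (Sum.inl (i, j))

/-- The second matrix of the pair. -/
def Bof {m p q : ℕ} {K : Type*} (x : PtV m p q K) : Matrix (Fin p) (Fin q) K :=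
  Matrix.of fun i j => x (Sum.inr (i, j))

/-- `V_{m,p,q} = {(A,B) : AB = 0}`. -/
def Vset (m p q : ℕ) (K : Type*) [CommRing K] : Set (PtV m p q K) :=
  {x | Aof x * Bof x = 0}

/-- The rank-bounded locus `V^{a,b}`, viewed inside `V_{m,p,q}`. -/
def Vab (m p q : ℕ) (K : Type*) [CommRing K] (a b : ℕ) : Set ↥(Vset m p q K) :=
  {x | (Aof x.1).rank ≤ a ∧ (Bof x.1).rank ≤ b}

/-- The constraints on the rank bounds `(a,b)`. -/
def goodV (m p q a b : ℕ) : Prop := b ≤ min p q ∧ a ≤ min (p - b) m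

/-- `(a,b)` is maximal among pairs satisfying the constraints. -/
def maxGoodV (m p q a b : ℕ) : Prop :=
  goodV m p q a b ∧ ∀ a' b', goodV m p q a' b' → a ≤ a' → b ≤ b' → a' = a ∧ b' = b

/-- An injective integral extension of commutative rings preserves the Krull dimension. -/
theorem ringKrullDim_eq_of_isIntegral (R S : Type*) [CommRing R] [CommRing S] [Algebra R S]
    [Algebra.IsIntegral R S] [FaithfulSMul R S] : ringKrullDim R = ringKrullDim S := by
  apply le_antisymm
  · refine iSup_le fun l => ?_
    obtain ⟨⟨P, hP, hPl⟩⟩ : Nonempty (Ideal.primesOver l.head.asIdeal S) := inferInstance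
    obtain ⟨L, hL, -⟩ := Ideal.exists_ltSeries_of_hasGoingUp (S := S) l P
    rw [← hL]
    exact Order.LTSeries.length_le_krullDim L
  · refine Order.krullDim_le_of_strictMono (PrimeSpectrum.comap (algebraMap R S)) fun P Q h => ?_
    exact Ideal.IsIntegral.comap_lt_comap h

/-- The Krull dimension of a finitely generated domain over a field over which a polynomial ring
is algebraic is the number of variables. -/
theorem ringKrullDim_eq_card_of_isAlgebraic {k R τ : Type*} [Field k] [CommRing R] [IsDomain R]
    [Algebra k R] [Algebra.FiniteType k R] [Finite τ] [Algebra R (MvPolynomial τ k)]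
    [IsScalarTower k R (MvPolynomial τ k)] [FaithfulSMul R (MvPolynomial τ k)]
    [Algebra.IsAlgebraic R (MvPolynomial τ k)] :
    ringKrullDim R = Nat.card τ := by
  obtain ⟨s, g, hg, hgi⟩ := exists_integral_inj_algHom_of_fg k R
  algebraize [g.toRingHom]
  have : FaithfulSMul (MvPolynomial (Fin s) k) R :=
    (faithfulSMul_iff_algebraMap_injective _ _).2 hg
  have : IsScalarTower k (MvPolynomial (Fin s) k) R :=
    IsScalarTower.of_algebraMap_eq fun x => (g.commutes x).symm
  rw [← ringKrullDim_eq_of_isIntegral (MvPolynomial (Fin s) k) R,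
    MvPolynomial.ringKrullDim_of_isNoetherianRing, ringKrullDim_eq_zero_of_field, zero_add]
  have h1 := lift_trdeg_add_eq k (MvPolynomial (Fin s) k) R
  have h2 := lift_trdeg_add_eq k R (MvPolynomial τ k)
  rw [trdeg_eq_zero (R := MvPolynomial (Fin s) k), MvPolynomial.trdeg_of_isDomain] at h1
  rw [trdeg_eq_zero (R := R), MvPolynomial.trdeg_of_isDomain] at h2
  simp at h1 h2
  rw [← h1] at h2
  have := congrArg Cardinal.toNat h2
  simp [Nat.card] at this ⊢
  exact_mod_cast this

section ZariskiTopology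

open MvPolynomial Topology

variable {m p q : ℕ} {K : Type*} [Field K]

/-- The coordinates of the affine space. -/
local notation "σ" => ((Fin m × Fin p) ⊕ (Fin p × Fin q))

lemma isTopologicalBasis_ptV : TopologicalSpace.IsTopologicalBasis
    {U : Set (PtV m p q K) | ∃ f : MvPolynomial σ K, U = {x | eval x f ≠ 0}} where
  exists_subset_inter := by
    rintro _ ⟨f, rfl⟩ _ ⟨g, rfl⟩ x ⟨hf, hg⟩
    exact ⟨_, ⟨f * g, rfl⟩, by simpa using! ⟨hf, hg⟩, fun y hy => by simpa using! hy⟩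
  sUnion_eq := Set.eq_univ_of_forall fun x => ⟨_, ⟨1, rfl⟩, by simp⟩
  eq_generateFrom := rfl

lemma isOpen_eval_ne_zero (f : MvPolynomial σ K) :
    IsOpen {x : PtV m p q K | eval x f ≠ 0} :=
  isTopologicalBasis_ptV.isOpen ⟨f, rfl⟩

lemma isClosed_eval_eq_zero (f : MvPolynomial σ K) :
    IsClosed {x : PtV m p q K | eval x f = 0} := by
  rw [← isOpen_compl_iff]
  exact isOpen_eval_ne_zero f

lemma isClosed_zeroLocus_s14 (I : Ideal (MvPolynomial σ K)) :
    IsClosed (zeroLocus K I : Set (PtV m p q K)) := by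
  have : (zeroLocus K I : Set (PtV m p q K)) = ⋂ f ∈ I, {x | eval x f = 0} := by
    ext x
    simp [aeval_eq_eval]
  rw [this]
  exact isClosed_biInter fun f _ => isClosed_eval_eq_zero f

lemma exists_eval_ne_zero_of_isOpen {U : Set (PtV m p q K)} (hU : IsOpen U) {x : PtV m p q K}
    (hx : x ∈ U) : ∃ f : MvPolynomial σ K, eval x f ≠ 0 ∧ ∀ y, eval y f ≠ 0 → y ∈ U := by
  obtain ⟨_, ⟨f, rfl⟩, hf, h⟩ := isTopologicalBasis_ptV.exists_subset_of_mem_open hx hU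
  exact ⟨f, hf, fun y hy => h hy⟩

lemma isIrreducible_of_isPrime_vanishingIdeal {S : Set (PtV m p q K)}
    (h : (vanishingIdeal K S).IsPrime) : IsIrreducible S := by
  refine ⟨?_, fun U V hU hV ⟨x, hxS, hx⟩ ⟨y, hyS, hy⟩ => ?_⟩
  · rw [Set.nonempty_iff_ne_empty]
    rintro rfl
    exact h.ne_top vanishingIdeal_empty
  · obtain ⟨f, hf, hfU⟩ := exists_eval_ne_zero_of_isOpen hU hx
    obtain ⟨g, hg, hgV⟩ := exists_eval_ne_zero_of_isOpen hV hy
    have hfg : f * g ∉ vanishingIdeal K S := fun hfg => by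
      rcases h.mem_or_mem hfg with hf' | hg'
      · exact hf (hf' x hxS)
      · exact hg (hg' y hyS)
    simp only [mem_vanishingIdeal_iff, not_forall, map_mul, mul_eq_zero, not_or] at hfg
    obtain ⟨z, hz, hzf, hzg⟩ := hfg
    exact ⟨z, hz, hfU z hzf, hgV z hzg⟩

/-- A subset of the source of an inducing map is irreducible if its image is. -/
lemma Topology.IsInducing.isIrreducible_of_image {X Y : Type*} [TopologicalSpace X]
    [TopologicalSpace Y] {i : Y → X} (hi : IsInducing i) {Z : Set Y}
    (h : IsIrreducible (i '' Z)) : IsIrreducible Z := by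
  refine ⟨Set.image_nonempty.1 h.1, fun U V hU hV ⟨x, hxS, hx⟩ ⟨y, hyS, hy⟩ => ?_⟩
  obtain ⟨U', hU', rfl⟩ := hi.isOpen_iff.1 hU
  obtain ⟨V', hV', rfl⟩ := hi.isOpen_iff.1 hV
  obtain ⟨_, ⟨z, hz, rfl⟩, hz'⟩ :=
    h.2 U' V' hU' hV' ⟨i x, ⟨x, hxS, rfl⟩, hx⟩ ⟨i y, ⟨y, hyS, rfl⟩, hy⟩
  exact ⟨z, hz, hz'⟩

/-- The dimension of a closed subvariety of affine space is that of its coordinate ring. -/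
theorem topologicalKrullDim_eq_ringKrullDim_quotient [IsAlgClosed K] {Y : Type*}
    [TopologicalSpace Y] {i : Y → PtV m p q K} (hi : IsInducing i) (hc : IsClosed (Set.range i)) :
    topologicalKrullDim Y =
      ringKrullDim (MvPolynomial σ K ⧸ vanishingIdeal K (Set.range i)) := by
  set I := vanishingIdeal K (Set.range i) with hI
  have hrange : zeroLocus K I = Set.range i := by
    refine Set.Subset.antisymm (fun x hx => by_contra fun hxi => ?_) (zeroLocus_vanishingIdeal_le _)
    obtain ⟨f, hf, h⟩ := exists_eval_ne_zero_of_isOpen hc.isOpen_compl hxi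
    exact hf (hx f fun y hy => by_contra fun hy' => h y hy' hy)
  apply le_antisymm
  · rw [← PrimeSpectrum.topologicalKrullDim_eq_ringKrullDim]
    let ev (y : Y) : MvPolynomial σ K ⧸ I →+* K :=
      Ideal.Quotient.lift I (eval (i y)) fun f hf => hf (i y) ⟨y, rfl⟩
    let j (y : Y) : PrimeSpectrum (MvPolynomial σ K ⧸ I) :=
      ⟨RingHom.ker (ev y), RingHom.ker_isPrime _⟩
    refine IsInducing.topologicalKrullDim_le (f := j) ⟨?_⟩
    rw [hi.eq_induced, isTopologicalBasis_ptV.eq_generateFrom,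
      PrimeSpectrum.isTopologicalBasis_basic_opens.eq_generateFrom, induced_generateFrom_eq,
      induced_generateFrom_eq]
    congr 1
    ext U
    constructor
    · rintro ⟨_, ⟨f, rfl⟩, rfl⟩
      exact ⟨_, ⟨Ideal.Quotient.mk I f, rfl⟩, rfl⟩
    · rintro ⟨_, ⟨f, rfl⟩, rfl⟩
      obtain ⟨f, rfl⟩ := Ideal.Quotient.mk_surjective f
      exact ⟨_, ⟨f, rfl⟩, rfl⟩
  · rw [ringKrullDim, ← Order.krullDim_orderDual]
    let J (P : (PrimeSpectrum (MvPolynomial σ K ⧸ I))ᵒᵈ) : Ideal (MvPolynomial σ K) :=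
      (OrderDual.ofDual P).asIdeal.comap (Ideal.Quotient.mk I)
    have hJ (P) : (J P).IsPrime := Ideal.IsPrime.comap _
    have hsub (P) : zeroLocus K (J P) ⊆ Set.range i := by
      rw [← hrange]
      refine zeroLocus_anti_mono fun f hf => ?_
      simp [J, Ideal.Quotient.eq_zero_iff_mem.2 hf]
    let F (P) : TopologicalSpace.IrreducibleCloseds Y :=
      { carrier := i ⁻¹' zeroLocus K (J P)
        isIrreducible' := hi.isIrreducible_of_image <| by
          rw [Set.image_preimage_eq_of_subset (hsub P)]
          apply isIrreducible_of_isPrime_vanishingIdeal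
          rw [IsPrime.vanishingIdeal_zeroLocus (h := hJ P)]
          exact hJ P
        isClosed' := (isClosed_zeroLocus_s14 _).preimage hi.continuous }
    refine Order.krullDim_le_of_strictMono F (Monotone.strictMono_of_injective ?_ ?_)
    · intro P Q h x hx
      exact zeroLocus_anti_mono (Ideal.comap_mono (OrderDual.ofDual_le_ofDual.2 h)) hx
    · intro P Q h
      have h1 : i '' (i ⁻¹' zeroLocus K (J P)) = i '' (i ⁻¹' zeroLocus K (J Q)) :=
        congrArg (fun Z => i '' (Z : TopologicalSpace.IrreducibleCloseds Y).carrier) h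
      rw [Set.image_preimage_eq_of_subset (hsub P), Set.image_preimage_eq_of_subset (hsub Q)] at h1
      have h2 : J P = J Q := by
        rw [← IsPrime.vanishingIdeal_zeroLocus (K := K) (h := hJ P), h1,
          IsPrime.vanishingIdeal_zeroLocus (h := hJ Q)]
      exact PrimeSpectrum.ext
        (Ideal.comap_injective_of_surjective _ Ideal.Quotient.mk_surjective h2)

/-- The vanishing ideal of the image of a polynomial map is the kernel of the comorphism. -/
lemma vanishingIdeal_range_eval [Infinite K] {ι τ : Type*} (F : ι → MvPolynomial τ K) :
    vanishingIdeal K (Set.range fun (y : τ → K) s => eval y (F s)) =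
      RingHom.ker (aeval F : MvPolynomial ι K →ₐ[K] MvPolynomial τ K) := by
  have key (y : τ → K) (f : MvPolynomial ι K) :
      eval y (aeval F f) = eval (fun s => eval y (F s)) f := by
    have := aeval_bind₁ (S := K) y F f
    rw [← aeval_eq_bind₁] at this
    simpa [aeval_eq_eval] using this
  ext f
  simp only [mem_vanishingIdeal_iff, Set.forall_mem_range, RingHom.mem_ker, aeval_eq_eval]
  constructor
  · exact fun h => MvPolynomial.funext fun y => by rw [key, h, map_zero]
  · intro h y
    rw [← key, h, map_zero]

end ZariskiTopology

section LinearAlgebra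

open Module

variable {K : Type*} [Field K]

lemma Submodule.exists_finrank_eq_of_le {V : Type*} [AddCommGroup V] [Module K V]
    [FiniteDimensional K V] {S T : Submodule K V} (hST : S ≤ T) {n : ℕ} (hS : finrank K S ≤ n)
    (hT : n ≤ finrank K T) : ∃ W : Submodule K V, S ≤ W ∧ W ≤ T ∧ finrank K W = n := by
  induction n, hS using Nat.le_induction with
  | base => exact ⟨S, le_rfl, hST, rfl⟩
  | succ n hn ih =>
    obtain ⟨W, hSW, hWT, hW⟩ := ih (by omega)
    obtain ⟨v, hvT, hvW⟩ := SetLike.exists_of_lt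
      (lt_of_le_of_ne hWT (by rintro rfl; omega))
    refine ⟨W ⊔ K ∙ v, hSW.trans le_sup_left, sup_le hWT ?_, ?_⟩
    · rwa [Submodule.span_singleton_le_iff_mem]
    · rw [Submodule.finrank_sup_span_singleton hvW, hW]

namespace Matrix

variable {m n : Type*} [Fintype n]

/-- A matrix of rank at least `r` has the identity matrix of size `r` as a two-sided multiple. -/
lemma exists_mul_mul_eq_one_of_le_rank [Fintype m] [DecidableEq m] [DecidableEq n]
    {A : Matrix m n K} {r : ℕ} (h : r ≤ A.rank) :
    ∃ (C : Matrix (Fin r) m K) (D : Matrix n (Fin r) K), C * A * D = 1 := by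
  obtain ⟨W, -, hW, hr⟩ := Submodule.exists_finrank_eq_of_le (bot_le (a := A.mulVecLin.range))
    (n := r) (by simp) h
  let e : (Fin r → K) ≃ₗ[K] W := LinearEquiv.ofFinrankEq _ _ (by simp [hr])
  obtain ⟨g, hg⟩ := Module.projective_lifting_property A.mulVecLin.rangeRestrict
    (Submodule.inclusion hW ∘ₗ e.toLinearMap) A.mulVecLin.surjective_rangeRestrict
  have hg' : A.mulVecLin ∘ₗ g = W.subtype ∘ₗ e.toLinearMap := by
    refine LinearMap.ext fun v => ?_
    exact congrArg Subtype.val (LinearMap.congr_fun hg _)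
  obtain ⟨k, hk⟩ := LinearMap.exists_leftInverse_of_injective (A.mulVecLin ∘ₗ g) <| by
    rw [hg', LinearMap.ker_eq_bot]
    exact Subtype.val_injective.comp e.injective
  refine ⟨LinearMap.toMatrix' k, LinearMap.toMatrix' g, ?_⟩
  rw [← LinearMap.toMatrix'_id, ← hk, LinearMap.toMatrix'_comp, LinearMap.toMatrix'_comp,
    Matrix.mul_assoc]
  congr
  exact (LinearMap.toMatrix'_toLin' A).symm

lemma le_rank_of_det_mul_mul_ne_zero [Fintype m] {A : Matrix m n K} {r : ℕ}
    {C : Matrix (Fin r) m K} {D : Matrix n (Fin r) K} (h : (C * A * D).det ≠ 0) : r ≤ A.rank := by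
  have := rank_of_det_ne_zero h
  rw [Fintype.card_fin] at this
  exact this.symm.trans_le ((rank_mul_le_left _ _).trans (rank_mul_le_right _ _))

lemma rank_diagonal_indicator [DecidableEq n] (s : Set n) :
    (diagonal (s.indicator (1 : n → K))).rank = Nat.card s := by
  classical
  rw [rank_diagonal, ← Nat.card_eq_fintype_card]
  exact Nat.card_congr (Equiv.subtypeEquivRight fun i => by simp)

/-- If `A * B = 0` then, after a change of basis of the middle space, `A` is supported on the
coordinates in a set `s` and `B` on those in its complement. -/
lemma exists_isUnit_det_of_mul_eq_zero [DecidableEq n] {o : Type*} [Fintype o]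
    {A : Matrix m n K} {B : Matrix n o K} (h : A * B = 0) (s : Set n) (hA : A.rank ≤ Nat.card s)
    (hB : B.rank ≤ Nat.card ↥sᶜ) :
    ∃ g : Matrix n n K, IsUnit g.det ∧ A * g * diagonal (sᶜ.indicator (1 : n → K)) = 0 ∧
      diagonal (s.indicator (1 : n → K)) * (g⁻¹ * B) = 0 := by
  classical
  let W₀ := (diagonal (sᶜ.indicator (1 : n → K))).mulVecLin.range
  have hW₀ : finrank K W₀ = Nat.card ↥sᶜ := rank_diagonal_indicator sᶜ
  have hker := A.mulVecLin.finrank_range_add_finrank_ker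
  rw [finrank_pi] at hker
  have hcard : Nat.card s + Nat.card ↥sᶜ = Fintype.card n := by
    rw [Nat.card_coe_set_eq, Nat.card_coe_set_eq, Set.ncard_add_ncard_compl,
      Nat.card_eq_fintype_card]
  have hle : B.mulVecLin.range ≤ A.mulVecLin.ker := by
    rw [LinearMap.range_le_ker_iff, ← mulVecLin_mul, h, mulVecLin_zero]
  obtain ⟨W, hBW, hWA, hW⟩ := Submodule.exists_finrank_eq_of_le hle hB
    (show Nat.card ↥sᶜ ≤ _ by unfold rank at hA; omega)
  obtain ⟨g, hg⟩ := Submodule.exists_linearEquiv_restrict_eq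
    (LinearEquiv.ofFinrankEq W₀ W (hW₀.trans hW.symm))
  set f := LinearEquiv.ofFinrankEq W₀ W (hW₀.trans hW.symm)
  have hG : LinearMap.toMatrix' g.toLinearMap * LinearMap.toMatrix' g.symm.toLinearMap = 1 := by
    rw [← LinearMap.toMatrix'_comp]
    simp
  refine ⟨LinearMap.toMatrix' g.toLinearMap, isUnit_det_of_right_inverse hG, ?_, ?_⟩
  · refine ext_of_mulVec_single fun i => ?_
    rw [← mulVec_mulVec, ← mulVec_mulVec, LinearMap.toMatrix'_mulVec, zero_mulVec]
    have := hg ⟨_, Pi.single i 1, rfl⟩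
    rw [LinearEquiv.coe_coe]
    exact (congrArg _ this.symm).trans (hWA (Subtype.prop _))
  · rw [inv_eq_right_inv hG]
    refine ext_of_mulVec_single fun i => ?_
    rw [← mulVec_mulVec, ← mulVec_mulVec, LinearMap.toMatrix'_mulVec, zero_mulVec]
    obtain ⟨u, hu⟩ := (f.symm ⟨_, hBW ⟨Pi.single i 1, rfl⟩⟩).2
    have h2 : B *ᵥ Pi.single i 1 = g (diagonal (sᶜ.indicator 1) *ᵥ u) := by
      rw [← mulVecLin_apply (diagonal _), hu, ← hg, LinearEquiv.apply_symm_apply]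
      rfl
    have h3 : diagonal (s.indicator (1 : n → K)) * diagonal (sᶜ.indicator 1) = 0 := by
      rw [diagonal_mul_diagonal, diagonal_eq_zero]
      ext j
      by_cases hj : j ∈ s <;> simp [hj]
    rw [LinearEquiv.coe_coe, h2, LinearEquiv.symm_apply_apply, mulVec_mulVec, h3, zero_mulVec]

end Matrix

end LinearAlgebra

section RankLocus

open MvPolynomial

variable {m p q : ℕ} {K : Type*}

/-- The point of affine space given by a pair of matrices. -/
def ptOfMatrices (A : Matrix (Fin m) (Fin p) K) (B : Matrix (Fin p) (Fin q) K) : PtV m p q K :=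
  Sum.elim (fun ij => A ij.1 ij.2) (fun ij => B ij.1 ij.2)

@[simp] lemma Aof_ptOfMatrices (A : Matrix (Fin m) (Fin p) K) (B : Matrix (Fin p) (Fin q) K) :
    Aof (ptOfMatrices A B) = A := rfl

@[simp] lemma Bof_ptOfMatrices (A : Matrix (Fin m) (Fin p) K) (B : Matrix (Fin p) (Fin q) K) :
    Bof (ptOfMatrices A B) = B := rfl

lemma ptOfMatrices_Aof_Bof (x : PtV m p q K) : ptOfMatrices (Aof x) (Bof x) = x := by
  ext (_ | _) <;> rfl

lemma map_ptOfMatrices {L : Type*} (f : K → L) (A : Matrix (Fin m) (Fin p) K)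
    (B : Matrix (Fin p) (Fin q) K) :
    (fun s => f (ptOfMatrices A B s)) = ptOfMatrices (A.map f) (B.map f) := by
  ext (_ | _) <;> rfl

variable [Field K]

lemma map_eval_Aof_X (x : PtV m p q K) :
    (Aof (X : PtV m p q (MvPolynomial _ K))).map (eval x) = Aof x := by
  ext; simp [Aof]

lemma map_eval_Bof_X (x : PtV m p q K) :
    (Bof (X : PtV m p q (MvPolynomial _ K))).map (eval x) = Bof x := by
  ext; simp [Bof]

lemma isClosed_map_eval_eq_zero {r t : Type*}
    (M : Matrix r t (MvPolynomial ((Fin m × Fin p) ⊕ (Fin p × Fin q)) K)) :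
    IsClosed {x : PtV m p q K | M.map (eval x) = 0} := by
  simp only [← Matrix.ext_iff, Set.ofPred_forall]
  exact isClosed_iInter fun i => isClosed_iInter fun j => isClosed_eval_eq_zero (M i j)

lemma isClosed_rank_map_eval_le {r t : Type*} [Fintype r] [Fintype t]
    (M : Matrix r t (MvPolynomial ((Fin m × Fin p) ⊕ (Fin p × Fin q)) K)) (k : ℕ) :
    IsClosed {x : PtV m p q K | (M.map (eval x)).rank ≤ k} := by
  classical
  let σ := (Fin m × Fin p) ⊕ (Fin p × Fin q)
  have : {x : PtV m p q K | (M.map (eval x)).rank ≤ k} =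
      ⋂ (D : Matrix (Fin (k + 1)) r K) (E : Matrix t (Fin (k + 1)) K),
        {x | eval x (D.map (C (σ := σ)) * M * E.map (C (σ := σ))).det = 0} := by
    ext x
    have h (D : Matrix (Fin (k + 1)) r K) (E : Matrix t (Fin (k + 1)) K) :
        eval x (D.map (C (σ := σ)) * M * E.map (C (σ := σ))).det =
          (D * M.map (eval x) * E).det := by
      rw [RingHom.map_det, RingHom.mapMatrix_apply, Matrix.map_mul, Matrix.map_mul]
      simp [Matrix.map_map, Function.comp_def]
    rw [Set.mem_iInter₂]
    constructor
    · intro hx D E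
      refine (h D E).trans ?_
      by_contra hDE
      exact (le_rank_of_det_mul_mul_ne_zero hDE).not_gt (Nat.lt_succ_of_le hx)
    · intro hx
      by_contra hk
      obtain ⟨D, E, hDE⟩ := exists_mul_mul_eq_one_of_le_rank (Nat.succ_le_of_lt (not_le.1 hk))
      have := (h D E).symm.trans (hx D E)
      simp [hDE] at this
  rw [this]
  exact isClosed_iInter fun D => isClosed_iInter fun E => isClosed_eval_eq_zero _

/-- The locus `V^{a,b}` as a subset of affine space. -/
def rankLocus (m p q : ℕ) (K : Type*) [Field K] (a b : ℕ) : Set (PtV m p q K) :=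
  {x | Aof x * Bof x = 0 ∧ (Aof x).rank ≤ a ∧ (Bof x).rank ≤ b}

lemma isClosed_rankLocus (a b : ℕ) : IsClosed (rankLocus m p q K a b) := by
  have h1 := isClosed_map_eval_eq_zero
    (Aof (X : PtV m p q (MvPolynomial _ K)) * Bof (X : PtV m p q (MvPolynomial _ K)))
  have h2 := isClosed_rank_map_eval_le (Aof (X : PtV m p q (MvPolynomial _ K))) a
  have h3 := isClosed_rank_map_eval_le (Bof (X : PtV m p q (MvPolynomial _ K))) b
  simp only [Matrix.map_mul, map_eval_Aof_X, map_eval_Bof_X] at h1 h2 h3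
  exact h1.inter (h2.inter h3)

lemma range_comp_val_Vab (a b : ℕ) :
    Set.range (fun x : Vab m p q K a b => x.1.1) = rankLocus m p q K a b := by
  ext x
  constructor
  · rintro ⟨x, rfl⟩
    exact ⟨x.1.2, x.2⟩
  · exact fun h => ⟨⟨⟨x, h.1⟩, h.2⟩, rfl⟩

lemma image_val_Vab (a b : ℕ) : Subtype.val '' Vab m p q K a b = rankLocus m p q K a b := by
  rw [← range_comp_val_Vab, Set.range_comp' Subtype.val Subtype.val, Subtype.range_val]

lemma isClosed_Vab (a b : ℕ) : IsClosed (Vab m p q K a b) := by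
  rw [← Subtype.val_injective.preimage_image (Vab m p q K a b), image_val_Vab]
  exact (isClosed_rankLocus a b).preimage continuous_subtype_val

/-- The generic matrix with entries indeterminates. -/
noncomputable abbrev genericMatrix (K : Type*) [CommSemiring K] {r t τ : Type*} (f : r × t → τ) :
    Matrix r t (MvPolynomial τ K) :=
  Matrix.of fun i j => X (f (i, j))

lemma map_eval_genericMatrix {r t τ : Type*} (f : r × t → τ) (y : τ → K) :
    (genericMatrix K f).map (eval y) = Matrix.of fun i j => y (f (i, j)) := by
  ext; simp

lemma map_C_map_eval {r t τ : Type*} (M : Matrix r t K) (y : τ → K) :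
    (M.map (C (σ := τ))).map (eval y) = M := by
  ext; simp

/-- The locus `V^{a,b}` is the image of an affine space. -/
lemma rankLocus_eq_range {a b : ℕ} (ha : a ≤ p) (hb : b = min (p - a) q) :
    ∃ F : (Fin m × Fin p) ⊕ (Fin p × Fin q) →
        MvPolynomial ((Fin m × Fin p) ⊕ (Fin p × Fin p) ⊕ (Fin p × Fin q)) K,
      rankLocus m p q K a b = Set.range fun y s => eval y (F s) := by
  let s : Set (Fin p) := {i | i.1 < a}
  have hs : Nat.card s = a := by
    rw [Nat.card_coe_set_eq, Set.ncard_eq_toFinset_card']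
    simp [s, Fin.card_filter_val_lt, ha]
  have hs' : Nat.card ↥sᶜ = p - a := by
    rw [Nat.card_coe_set_eq, Set.ncard_compl, ← Nat.card_coe_set_eq, hs, Nat.card_fin]
  let D : Matrix (Fin p) (Fin p) K := diagonal (s.indicator 1)
  let D' : Matrix (Fin p) (Fin p) K := diagonal (sᶜ.indicator 1)
  have hD : D.rank = a := (rank_diagonal_indicator s).trans hs
  have hD' : D'.rank = p - a := (rank_diagonal_indicator sᶜ).trans hs'
  have hDD' : D * D' = 0 := by
    rw [diagonal_mul_diagonal, diagonal_eq_zero]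
    ext j
    by_cases hj : j ∈ s <;> simp [hj]
  have hadd : D + D' = 1 := by
    rw [diagonal_add, ← diagonal_one]
    congr 1
    ext j
    by_cases hj : j ∈ s <;> simp [hj]
  let τ := (Fin m × Fin p) ⊕ (Fin p × Fin p) ⊕ (Fin p × Fin q)
  let P : Matrix _ _ (MvPolynomial τ K) := genericMatrix K Sum.inl
  let G : Matrix _ _ (MvPolynomial τ K) := genericMatrix K fun s => Sum.inr (Sum.inl s)
  let Q : Matrix _ _ (MvPolynomial τ K) := genericMatrix K fun s => Sum.inr (Sum.inr s)
  let F : PtV m p q (MvPolynomial τ K) :=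
    ptOfMatrices (P * D.map (C (σ := τ)) * G.adjugate) (G * D'.map (C (σ := τ)) * Q)
  have hF (y : τ → K) : (fun s => eval y (F s)) = ptOfMatrices
      (P.map (eval y) * D * (G.map (eval y)).adjugate) (G.map (eval y) * D' * Q.map (eval y)) := by
    have hG : G.adjugate.map (eval y) = (G.map (eval y)).adjugate := (eval y).map_adjugate G
    rw [map_ptOfMatrices]
    simp only [Matrix.map_mul, map_C_map_eval, hG]
  refine ⟨F, Set.Subset.antisymm ?_ ?_⟩
  · rintro x ⟨hx, hA, hB⟩
    obtain ⟨g, hg, hgA, hgB⟩ := exists_isUnit_det_of_mul_eq_zero hx s (hA.trans_eq hs.symm)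
      (hB.trans (by rw [hs', hb]; exact min_le_left _ _))
    let P₀ : Matrix _ _ K := g.det⁻¹ • (Aof x * g)
    let Q₀ := g⁻¹ * Bof x
    refine ⟨Sum.elim (fun ij => P₀ ij.1 ij.2)
      (Sum.elim (fun ij => g ij.1 ij.2) (fun ij => Q₀ ij.1 ij.2)), ?_⟩
    have h1 : Aof x * g * D = Aof x * g := by
      rw [← add_zero (Aof x * g * D), ← hgA, ← Matrix.mul_add, hadd, Matrix.mul_one]
    have h2 : D' * (g⁻¹ * Bof x) = g⁻¹ * Bof x := by
      rw [← zero_add (D' * _), ← hgB, ← Matrix.add_mul, hadd, Matrix.one_mul]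
    refine ((hF _).trans ?_).trans (ptOfMatrices_Aof_Bof x)
    simp only [P, G, Q, map_eval_genericMatrix]
    congr 1
    · change P₀ * D * g.adjugate = _
      rw [Matrix.smul_mul, h1, Matrix.smul_mul, Matrix.mul_assoc, mul_adjugate, Matrix.mul_smul,
        smul_smul, inv_mul_cancel₀ hg.ne_zero, one_smul, Matrix.mul_one]
    · change g * D' * Q₀ = _
      rw [Matrix.mul_assoc, h2, mul_nonsing_inv_cancel_left _ _ hg]
  · rintro _ ⟨y, rfl⟩
    dsimp only
    rw [show (fun s => eval y (F s)) = _ from hF y]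
    generalize P.map (eval y) = P₀
    generalize G.map (eval y) = g
    generalize Q.map (eval y) = Q₀
    refine ⟨?_, ?_, ?_⟩
    · rw [Aof_ptOfMatrices, Bof_ptOfMatrices, Matrix.mul_assoc, Matrix.mul_assoc g,
        ← Matrix.mul_assoc g.adjugate, adjugate_mul, Matrix.smul_mul, Matrix.one_mul,
        Matrix.mul_smul, Matrix.mul_assoc, ← Matrix.mul_assoc D, hDD', Matrix.zero_mul,
        Matrix.mul_zero, smul_zero]
    · rw [Aof_ptOfMatrices]
      refine (rank_mul_le_left _ _).trans ((rank_mul_le_right _ _).trans ?_)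
      exact hD.le
    · rw [Bof_ptOfMatrices, hb]
      refine le_min ?_ (rank_le_width _)
      refine (rank_mul_le_left _ _).trans ((rank_mul_le_right _ _).trans ?_)
      exact hD'.le

lemma isPrime_vanishingIdeal_rankLocus [Infinite K] {a b : ℕ} (ha : a ≤ p)
    (hb : b = min (p - a) q) : (vanishingIdeal K (rankLocus m p q K a b)).IsPrime := by
  obtain ⟨F, hF⟩ := rankLocus_eq_range (K := K) (m := m) ha hb
  rw [hF, vanishingIdeal_range_eval]
  exact RingHom.ker_isPrime _

lemma isIrreducible_Vab [Infinite K] {a b : ℕ} (ha : a ≤ p) (hb : b = min (p - a) q) :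
    IsIrreducible (Vab m p q K a b) := by
  apply Topology.IsInducing.subtypeVal.isIrreducible_of_image
  rw [image_val_Vab]
  exact isIrreducible_of_isPrime_vanishingIdeal (isPrime_vanishingIdeal_rankLocus ha hb)

end RankLocus

section Components

variable {m p q : ℕ} {K : Type*} [Field K]

lemma maxGoodV.eq_min {a b : ℕ} (h : maxGoodV m p q a b) :
    a = min (p - b) m ∧ b = min (p - a) q ∧ a + b ≤ p := by
  obtain ⟨h1, h2⟩ := h
  unfold goodV at h1 h2
  have h3 := h2 (a + 1) b
  have h4 := h2 a (b + 1)
  omega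

lemma goodV.exists_le_maxGoodV {a b : ℕ} (h : goodV m p q a b) :
    ∃ a' b', maxGoodV m p q a' b' ∧ a ≤ a' ∧ b ≤ b' := by
  have hfin : {x : ℕ × ℕ | goodV m p q x.1 x.2}.Finite :=
    (Set.finite_Iic (m, q)).subset fun x hx =>
      ⟨hx.2.trans (min_le_right _ _), hx.1.trans (min_le_right _ _)⟩
  obtain ⟨⟨a', b'⟩, hle, hmax⟩ := hfin.exists_le_maximal (a := (a, b)) h
  refine ⟨a', b', ⟨hmax.prop, fun a'' b'' h' ha hb => ?_⟩, hle.1, hle.2⟩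
  have := hmax.le_of_ge (y := (a'', b'')) h' ⟨ha, hb⟩
  exact ⟨this.1.antisymm ha, this.2.antisymm hb⟩

lemma exists_maxGoodV_mem_Vab (x : Vset m p q K) :
    ∃ a b, maxGoodV m p q a b ∧ x ∈ Vab m p q K a b := by
  have h := rank_add_rank_le_card_of_mul_eq_zero x.2
  rw [Fintype.card_fin] at h
  have hA := rank_le_height (Aof x.1)
  have hB := rank_le_width (Bof x.1)
  obtain ⟨a, b, hab, ha, hb⟩ := goodV.exists_le_maxGoodV (m := m) (p := p) (q := q)
    (a := (Aof x.1).rank) (b := (Bof x.1).rank) (by unfold goodV; omega)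
  exact ⟨a, b, hab, ha, hb⟩

lemma IsIrreducible.exists_subset_Vab {S : Set (Vset m p q K)} (hS : IsIrreducible S) :
    ∃ a b, maxGoodV m p q a b ∧ S ⊆ Vab m p q K a b := by
  classical
  have hfin : {x : ℕ × ℕ | maxGoodV m p q x.1 x.2}.Finite :=
    (Set.finite_Iic (m, q)).subset fun x hx =>
      ⟨hx.1.2.trans (min_le_right _ _), hx.1.1.trans (min_le_right _ _)⟩
  obtain ⟨_, hz, hSz⟩ := isIrreducible_iff_sUnion_isClosed.1 hS
    (hfin.toFinset.image fun x => Vab m p q K x.1 x.2)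
    (by simp only [Finset.forall_mem_image]; exact fun _ _ => isClosed_Vab _ _)
    (fun x _ => by
      obtain ⟨a, b, hab, hx⟩ := exists_maxGoodV_mem_Vab x
      exact ⟨_, Finset.mem_coe.2 (Finset.mem_image.2 ⟨(a, b), by simpa using! hab, rfl⟩), hx⟩)
  obtain ⟨x, hx, rfl⟩ := Finset.mem_image.1 hz
  exact ⟨x.1, x.2, by simpa using hx, hSz⟩

lemma rank_submatrix_one_mul_submatrix_one {n o : Type*} [Fintype n] [Fintype o] [DecidableEq n]
    [DecidableEq o] {r : ℕ} {f : Fin r → n} {g : Fin r → o} (hf : f.Injective)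
    (hg : g.Injective) :
    ((1 : Matrix n n K).submatrix id f * (1 : Matrix o o K).submatrix g id).rank = r := by
  apply le_antisymm
  · exact (rank_mul_le_left _ _).trans ((rank_le_card_width _).trans_eq (Fintype.card_fin r))
  · apply le_rank_of_det_mul_mul_ne_zero (C := (1 : Matrix n n K).submatrix f id)
      (D := (1 : Matrix o o K).submatrix id g)
    rw [← Matrix.mul_assoc, Matrix.mul_assoc, ← submatrix_mul _ _ _ _ _ Function.bijective_id,
      ← submatrix_mul _ _ _ _ _ Function.bijective_id, Matrix.one_mul, Matrix.one_mul,
      submatrix_one _ hf, submatrix_one _ hg]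
    simp

lemma exists_rank_eq {a b : ℕ} (ha : a ≤ m) (hb : b ≤ q) (hab : a + b ≤ p) :
    ∃ x : Vset m p q K, (Aof x.1).rank = a ∧ (Bof x.1).rank = b := by
  let f : Fin a → Fin p := Fin.castLE (by omega)
  let g : Fin b → Fin p := fun i => ⟨a + i, by omega⟩
  have hf : f.Injective := Fin.castLE_injective _
  have hg : g.Injective := fun i j h => by
    simp only [g, Fin.mk.injEq] at h
    omega
  refine ⟨⟨ptOfMatrices
    ((1 : Matrix _ _ K).submatrix id (Fin.castLE ha) * (1 : Matrix _ _ K).submatrix f id)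
    ((1 : Matrix _ _ K).submatrix id g * (1 : Matrix _ _ K).submatrix (Fin.castLE hb) id), ?_⟩,
    ?_, ?_⟩
  · have hfg : (1 : Matrix (Fin p) (Fin p) K).submatrix f g = 0 := by
      ext i j
      refine one_apply_ne fun h => ?_
      simp only [f, g, Fin.ext_iff, Fin.val_castLE] at h
      omega
    change _ * _ = _
    rw [Aof_ptOfMatrices, Bof_ptOfMatrices, ← Matrix.mul_assoc, Matrix.mul_assoc (submatrix _ _ _),
      ← submatrix_mul _ _ _ _ _ Function.bijective_id, Matrix.one_mul, hfg, Matrix.mul_zero,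
      Matrix.zero_mul]
  · exact rank_submatrix_one_mul_submatrix_one (Fin.castLE_injective _) hf
  · exact rank_submatrix_one_mul_submatrix_one hg (Fin.castLE_injective _)

lemma le_of_Vab_subset {a b a' b' : ℕ} (hab : goodV m p q a b)
    (h : Vab m p q K a b ⊆ Vab m p q K a' b') : a ≤ a' ∧ b ≤ b' := by
  unfold goodV at hab
  obtain ⟨x, hxa, hxb⟩ := exists_rank_eq (K := K) (show a ≤ m by omega) (show b ≤ q by omega)
    (show a + b ≤ p by omega)
  have := h (show x ∈ Vab m p q K a b from ⟨hxa.le, hxb.le⟩)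
  exact ⟨hxa.symm.trans_le this.1, hxb.symm.trans_le this.2⟩

theorem irreducibleComponents_Vset [Infinite K] :
    irreducibleComponents ↥(Vset m p q K) =
      {S | ∃ a b, maxGoodV m p q a b ∧ S = Vab m p q K a b} := by
  have hirr {a b : ℕ} (h : maxGoodV m p q a b) : IsIrreducible (Vab m p q K a b) :=
    isIrreducible_Vab (by have := h.eq_min; omega) h.eq_min.2.1
  ext S
  constructor
  · intro hS
    obtain ⟨a, b, hab, hSab⟩ := IsIrreducible.exists_subset_Vab hS.1
    exact ⟨a, b, hab, hSab.antisymm (hS.2 (hirr hab) hSab)⟩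
  · rintro ⟨a, b, hab, rfl⟩
    refine ⟨hirr hab, fun T hT hle => ?_⟩
    obtain ⟨a', b', hab', hT'⟩ := IsIrreducible.exists_subset_Vab hT
    obtain ⟨ha, hb⟩ := le_of_Vab_subset hab.1 (hle.trans hT')
    obtain ⟨rfl, rfl⟩ := hab.2 a' b' hab'.1 ha hb
    exact hT'

end Components

section Dimension

open MvPolynomial

/-- A parametrised affine variety whose parametrising polynomials generate a ring over which the
parameters are algebraic has dimension the number of parameters. -/
lemma ringKrullDim_quotient_ker_aeval {K σ τ : Type*} [Field K] [Finite σ] [Finite τ]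
    (F : σ → MvPolynomial τ K)
    (h : ∀ t, IsAlgebraic (aeval F : MvPolynomial σ K →ₐ[K] MvPolynomial τ K).range
      (X t : MvPolynomial τ K)) :
    ringKrullDim
      (MvPolynomial σ K ⧸ RingHom.ker (aeval F : MvPolynomial σ K →ₐ[K] MvPolynomial τ K)) =
      Nat.card τ := by
  let φ : MvPolynomial σ K →ₐ[K] MvPolynomial τ K := aeval F
  rw [ringKrullDim_eq_of_ringEquiv (Ideal.quotientKerEquivRange φ).toRingEquiv]
  have : Algebra.FiniteType K φ.range :=
    Algebra.FiniteType.of_surjective φ.rangeRestrict φ.rangeRestrict_surjective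
  have : Algebra.IsAlgebraic φ.range (MvPolynomial τ K) := by
    refine ⟨fun f => ?_⟩
    induction f using MvPolynomial.induction_on with
    | C k => exact isAlgebraic_algebraMap (algebraMap K φ.range k)
    | add f g hf hg => exact hf.add hg
    | mul_X f t hf => exact hf.mul (h t)
  exact ringKrullDim_eq_card_of_isAlgebraic (k := K)

variable {m a c q : ℕ}

/-- A chart of the locus of pairs `(A, B)` with `A * B = 0` and `rank A ≤ a`. -/
def chartPt {R : Type*} [CommRing R] (P : Matrix (Fin m) (Fin a) R) (C : Matrix (Fin a) (Fin c) R)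
    (Q : Matrix (Fin c) (Fin q) R) : PtV m (a + c) q R :=
  ptOfMatrices ((fromCols P (P * C)).submatrix id finSumFinEquiv.symm)
    ((fromRows (-(C * Q)) Q).submatrix finSumFinEquiv.symm id)

lemma map_chartPt {R S : Type*} [CommRing R] [CommRing S] (f : R →+* S)
    (P : Matrix (Fin m) (Fin a) R) (C : Matrix (Fin a) (Fin c) R) (Q : Matrix (Fin c) (Fin q) R) :
    (fun s => f (chartPt P C Q s)) = chartPt (P.map f) (C.map f) (Q.map f) := by
  rw [chartPt, map_ptOfMatrices, chartPt, ← submatrix_map, ← submatrix_map, fromCols_map,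
    fromRows_map, Matrix.map_mul, Matrix.map_neg, Matrix.map_mul]
  exact map_neg f

variable {K : Type*} [Field K]

lemma chartPt_mem_rankLocus {b : ℕ} (hb : b = min c q) (P : Matrix (Fin m) (Fin a) K)
    (C : Matrix (Fin a) (Fin c) K) (Q : Matrix (Fin c) (Fin q) K) :
    chartPt P C Q ∈ rankLocus m (a + c) q K a b := by
  refine ⟨?_, ?_, ?_⟩
  · rw [chartPt, Aof_ptOfMatrices, Bof_ptOfMatrices, submatrix_mul_equiv, fromCols_mul_fromRows]
    simp [Matrix.mul_assoc]
  · rw [chartPt, Aof_ptOfMatrices]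
    have : fromCols P (P * C) = P * fromCols 1 C := by rw [mul_fromCols, Matrix.mul_one]
    rw [this]
    refine (rank_submatrix_le _ _ _).trans ((rank_mul_le_left _ _).trans (rank_le_width _))
  · rw [chartPt, Bof_ptOfMatrices, hb]
    refine le_min ?_ (rank_le_width _)
    have : fromRows (-(C * Q)) Q = fromRows (-C) 1 * Q := by
      rw [fromRows_mul, Matrix.one_mul, Matrix.neg_mul]
    rw [this]
    refine (rank_submatrix_le _ _ _).trans ((rank_mul_le_right _ _).trans (rank_le_height _))

/-- If the first columns of `A` have an invertible maximal minor and `rank A` is the number of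
these columns, then they span the other ones. -/
lemma exists_eq_mul_of_rank_le {r n o : Type*} [Fintype n] [DecidableEq n] [Fintype o] [Fintype r]
    {A : Matrix r o K} {f : n → r} {g : n → o} (hdet : (A.submatrix f g).det ≠ 0)
    (hA : A.rank ≤ Fintype.card n) {t : Type*} [Finite t] (h : t → o) :
    ∃ C : Matrix n t K, A.submatrix id h = A.submatrix id g * C := by
  classical
  have hle : (A.submatrix id g).mulVecLin.range ≤ A.mulVecLin.range := by
    rw [range_mulVecLin, range_mulVecLin]
    refine Submodule.span_mono ?_
    rintro _ ⟨i, rfl⟩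
    exact ⟨g i, rfl⟩
  have heq := Submodule.eq_of_le_of_finrank_le hle <| hA.trans <| by
    rw [← rank_of_det_ne_zero hdet]
    exact rank_submatrix_le (A.submatrix id g) f id
  have hmem (j : t) : ∃ v, A.submatrix id g *ᵥ v = fun i => A i (h j) := by
    have : (fun i => A i (h j)) ∈ A.mulVecLin.range := by
      rw [range_mulVecLin]
      exact Submodule.subset_span ⟨h j, rfl⟩
    rwa [← heq] at this
  choose v hv using hmem
  refine ⟨of fun i j => v j i, ?_⟩
  ext i j
  exact (congrFun (hv j) i).symm

lemma exists_chartPt_eq {b : ℕ} (ha : a ≤ m) {x : PtV m (a + c) q K}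
    (hx : x ∈ rankLocus m (a + c) q K a b)
    (hdet : ((Aof x).submatrix (Fin.castLE ha) (Fin.castAdd c)).det ≠ 0) :
    ∃ P C Q, chartPt P C Q = x := by
  obtain ⟨hAB, hA, -⟩ := hx
  obtain ⟨C, hC⟩ := exists_eq_mul_of_rank_le hdet (by simpa using hA) (Fin.natAdd a)
  set P := (Aof x).submatrix id (Fin.castAdd c) with hP
  set Q := (Bof x).submatrix (Fin.natAdd a) id with hQ
  have hAx : Aof x = (fromCols P (P * C)).submatrix id finSumFinEquiv.symm := by
    rw [← hC]
    ext i j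
    induction j using Fin.addCases <;> simp [P]
  have hBx : Bof x = (fromRows ((Bof x).submatrix (Fin.castAdd c) id) Q).submatrix
      finSumFinEquiv.symm id := by
    ext i j
    induction i using Fin.addCases <;> simp [Q]
  have h0 : P * ((Bof x).submatrix (Fin.castAdd c) id + C * Q) = 0 := by
    rw [hAx, hBx, submatrix_mul_equiv, fromCols_mul_fromRows] at hAB
    rw [Matrix.mul_add, ← Matrix.mul_assoc]
    exact hAB
  have h1 : (Bof x).submatrix (Fin.castAdd c) id = -(C * Q) := by
    rw [← add_eq_zero_iff_eq_neg]
    have h2 := congrArg (fun M => M.submatrix (Fin.castLE ha) id) h0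
    have h3 : (Aof x).submatrix (Fin.castLE ha) (Fin.castAdd c) *
        ((Bof x).submatrix (Fin.castAdd c) id + C * Q) = 0 := h2
    rw [← nonsing_inv_mul_cancel_left _ (_ + _) (isUnit_iff_ne_zero.2 hdet), h3, Matrix.mul_zero]
  refine ⟨P, C, Q, ?_⟩
  rw [chartPt, ← h1, ← hAx, ← hBx, ptOfMatrices_Aof_Bof]

/-- The parameter space of the chart. -/
local notation "τ" => ((Fin m × Fin a) ⊕ (Fin a × Fin c) ⊕ (Fin c × Fin q))

variable (m a c q K) in
/-- The chart with generic parameters. -/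
noncomputable def genericChartPt : PtV m (a + c) q (MvPolynomial τ K) :=
  chartPt (genericMatrix K Sum.inl) (genericMatrix K fun s => Sum.inr (Sum.inl s))
    (genericMatrix K fun s => Sum.inr (Sum.inr s))

lemma range_eval_genericChartPt :
    (Set.range fun (y : τ → K) s => eval y (genericChartPt m a c q K s)) =
      {x | ∃ P C Q, chartPt P C Q = x} := by
  ext x
  constructor
  · rintro ⟨y, rfl⟩
    exact ⟨_, _, _, (map_chartPt (R := MvPolynomial τ K) (eval y) _ _ _).symm⟩
  · rintro ⟨P, C, Q, rfl⟩
    refine ⟨Sum.elim (fun ij => P ij.1 ij.2)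
      (Sum.elim (fun ij => C ij.1 ij.2) (fun ij => Q ij.1 ij.2)), ?_⟩
    refine (map_chartPt (R := MvPolynomial τ K) (eval _) _ _ _).trans ?_
    simp only [map_eval_genericMatrix]
    rfl

lemma vanishingIdeal_rankLocus [Infinite K] {b : ℕ} (ha : a ≤ m) (hb : b = min c q) :
    vanishingIdeal K (rankLocus m (a + c) q K a b) =
      RingHom.ker (aeval (genericChartPt m a c q K)) := by
  rw [← vanishingIdeal_range_eval, range_eval_genericChartPt]
  apply le_antisymm
  · apply vanishingIdeal_anti_mono
    rintro _ ⟨P, C, Q, rfl⟩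
    exact chartPt_mem_rankLocus hb P C Q
  · intro f hf
    have hprime := isPrime_vanishingIdeal_rankLocus (K := K) (m := m) (q := q) (b := b)
      (Nat.le_add_right a c) (by simpa using hb)
    let M := (Aof (X : PtV m (a + c) q (MvPolynomial _ K))).submatrix (Fin.castLE ha)
      (Fin.castAdd c)
    have hM (x : PtV m (a + c) q K) :
        eval x M.det = ((Aof x).submatrix (Fin.castLE ha) (Fin.castAdd c)).det := by
      rw [RingHom.map_det, RingHom.mapMatrix_apply, ← submatrix_map, map_eval_Aof_X]
    refine (hprime.mem_or_mem (x := f) (y := M.det) ?_).resolve_right fun h => ?_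
    · intro x hx
      rw [aeval_eq_eval, map_mul, hM]
      by_cases hdet : ((Aof x).submatrix (Fin.castLE ha) (Fin.castAdd c)).det = 0
      · rw [hdet, mul_zero]
      · have : eval x f = 0 := hf x (exists_chartPt_eq ha hx hdet)
        rw [this, zero_mul]
    · have h1 : eval _ M.det = 0 :=
        h _ (chartPt_mem_rankLocus hb ((1 : Matrix _ _ K).submatrix id (Fin.castLE ha)) 0 0)
      rw [hM, chartPt, Aof_ptOfMatrices] at h1
      refine one_ne_zero ((det_one (n := Fin a) (R := K)).symm.trans
        (Eq.trans (congrArg det ?_) h1))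
      ext i j
      simp [one_apply, Fin.ext_iff]

lemma isAlgebraic_X_range_aeval_genericChartPt (ha : a ≤ m) (t : τ) :
    IsAlgebraic (aeval (genericChartPt m a c q K) :
      MvPolynomial _ K →ₐ[K] MvPolynomial τ K).range (X t : MvPolynomial τ K) := by
  set S := (aeval (genericChartPt m a c q K) : MvPolynomial _ K →ₐ[K] MvPolynomial τ K).range
  have hS (s) : genericChartPt m a c q K s ∈ S := ⟨X s, by simp⟩
  let P : Matrix _ _ (MvPolynomial τ K) := genericMatrix K Sum.inl
  let C : Matrix _ _ (MvPolynomial τ K) := genericMatrix K fun s => Sum.inr (Sum.inl s)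
  have hP (i j) : P i j ∈ S := by
    convert hS (Sum.inl (i, Fin.castAdd c j))
    simp [genericChartPt, chartPt, ptOfMatrices, P]
  have hPC (i j) : (P * C) i j ∈ S := by
    convert hS (Sum.inl (i, Fin.natAdd a j))
    simp [genericChartPt, chartPt, ptOfMatrices, P, C]
  rcases t with ⟨i, j⟩ | ⟨i, j⟩ | ⟨i, j⟩
  · exact isAlgebraic_algebraMap (⟨_, hP i j⟩ : S)
  · let T : Matrix _ _ S := of fun i j => ⟨_, hP (Fin.castLE ha i) j⟩
    let N : Matrix _ _ S := of fun i j => ⟨_, hPC (Fin.castLE ha i) j⟩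
    have hT : T.map (algebraMap S (MvPolynomial τ K)) = P.submatrix (Fin.castLE ha) id := rfl
    have hN : N.map (algebraMap S (MvPolynomial τ K)) =
        T.map (algebraMap S (MvPolynomial τ K)) * C := rfl
    have hdet : algebraMap S (MvPolynomial τ K) T.det ≠ 0 := by
      intro h0
      have := congrArg (eval (Sum.elim (fun ij => if ij.1.1 = ij.2.1 then 1 else 0) 0)) h0
      rw [RingHom.map_det, RingHom.mapMatrix_apply, hT, RingHom.map_det, RingHom.mapMatrix_apply,
        ← submatrix_map, map_eval_genericMatrix] at this
      have h1 : (of fun (i : Fin m) (j : Fin a) => if i.1 = j.1 then (1 : K) else 0).submatrix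
          (Fin.castLE ha) id = 1 := by
        ext i j
        simp [one_apply, Fin.ext_iff]
      simp [h1] at this
    have h1 : T.adjugate.map (algebraMap S (MvPolynomial τ K)) =
        (T.map (algebraMap S (MvPolynomial τ K))).adjugate :=
      (algebraMap S (MvPolynomial τ K)).map_adjugate T
    have h2 : (T.adjugate * N).map (algebraMap S (MvPolynomial τ K)) =
        algebraMap S (MvPolynomial τ K) T.det • C := by
      rw [Matrix.map_mul, hN, h1, ← Matrix.mul_assoc, adjugate_mul, Matrix.smul_mul,
        Matrix.one_mul, RingHom.map_det, RingHom.mapMatrix_apply]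
    have h3 : algebraMap S (MvPolynomial τ K) ((T.adjugate * N) i j) =
        algebraMap S (MvPolynomial τ K) T.det * X (Sum.inr (Sum.inl (i, j))) :=
      congrFun (congrFun h2 i) j
    refine IsAlgebraic.of_mul (mem_nonZeroDivisors_of_ne_zero hdet)
      (isAlgebraic_algebraMap T.det) ?_
    rw [← h3]
    exact isAlgebraic_algebraMap _
  · refine isAlgebraic_algebraMap (⟨X (Sum.inr (Sum.inr (i, j))), ?_⟩ : S)
    convert hS (Sum.inr (Fin.natAdd a i, j))
    simp [genericChartPt, chartPt, ptOfMatrices]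

theorem topologicalKrullDim_Vab [IsAlgClosed K] {b : ℕ} (ha : a ≤ m) (hb : b = min c q) :
    topologicalKrullDim (Vab m (a + c) q K a b) = (m * a + a * c + c * q : ℕ) := by
  have : Infinite K := IsAlgClosed.instInfinite
  have hi : Topology.IsInducing fun x : Vab m (a + c) q K a b => x.1.1 :=
    Topology.IsInducing.subtypeVal.comp Topology.IsInducing.subtypeVal
  have hr := range_comp_val_Vab (m := m) (p := a + c) (q := q) (K := K) a b
  rw [topologicalKrullDim_eq_ringKrullDim_quotient hi (hr ▸ isClosed_rankLocus a b), hr,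
    vanishingIdeal_rankLocus ha hb, ringKrullDim_quotient_ker_aeval _
      (isAlgebraic_X_range_aeval_genericChartPt ha)]
  simp [add_assoc]

end Dimension

/-- The irreducible components of `V_{m,p,q}` are exactly the loci `V^{a,b}` for maximal
`(a,b)` with `b ≤ min{p,q}`, `a ≤ min{p-b,m}`, and
`dim V^{a,b} = a(p+m-a) + b(p+q-b) - ab`. -/
theorem stmt14 (m p q : ℕ) (K : Type*) [Field K] [IsAlgClosed K] :
    irreducibleComponents ↥(Vset m p q K) =
      {S | ∃ a b, maxGoodV m p q a b ∧ S = Vab m p q K a b} ∧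
    ∀ a b, maxGoodV m p q a b →
      topologicalKrullDim (Vab m p q K a b) =
        ((a * (p + m - a) + b * (p + q - b) - a * b : ℕ) : WithBot ℕ∞) := by
  have : Infinite K := IsAlgClosed.instInfinite
  refine ⟨irreducibleComponents_Vset, fun a b hab => ?_⟩
  obtain ⟨h1, h2, h3⟩ := hab.eq_min
  obtain ⟨c, rfl⟩ : ∃ c, p = a + c := ⟨p - a, by omega⟩
  rw [Nat.add_sub_cancel_left] at h2
  rw [topologicalKrullDim_Vab (by omega) h2]
  congr 2
  have h4 : a + c + m - a = c + m := by omega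
  have h5 : a + c + q - b = a + (c + q - b) := by omega
  have h6 : b * (c + q - b) = c * q := by
    rcases le_total c q with h | h
    · rw [min_eq_left h] at h2
      rw [h2, Nat.add_sub_cancel_left]
    · rw [min_eq_right h] at h2
      rw [h2, Nat.add_sub_cancel, mul_comm]
  rw [h4, h5, mul_add b, h6, eq_comm, Nat.sub_eq_iff_eq_add] <;> nlinarith
end
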